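/- arXiv:1001.4249 — 2 statements merged into one kernel-verified Lean document; each statement's English description precedes it below -/
import Mathlib

section
/- Let H be a graph on h vertices and r = χ_c(P*(H)) the coloring number of the hereditary property of H-free graphs (induced). For every ξ > 0 there is ρ > 0 such that for sufficiently large n, the number S_n of labelled graphs on [n] containing at most ρ·n^h induced copies of H satisfies (1 - 1/r)·C(n,2) ≤ log₂ S_n ≤ (1 - 1/r + ξ)·C(n,2). -/
open SimpleGraph

/-- `G` has a vertex partition into `s` cliques and `r - s` independent sets. -/
def InH (r s : ℕ) {V : Type*} (G : SimpleGraph V) : Prop :=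
  ∃ f : V → Fin r,
    (∀ i : Fin r, (i:ℕ) < s → ∀ a b, f a = i → f b = i → a ≠ b → G.Adj a b) ∧
    (∀ i : Fin r, s ≤ (i:ℕ) → ∀ a b, f a = i → f b = i → ¬ G.Adj a b)

/-- All graphs partitionable into `s` cliques and `r - s` independent sets, for some `s ≤ r`,
are induced-`H`-free. -/
def GoodR {h : ℕ} (H : SimpleGraph (Fin h)) (r : ℕ) : Prop :=
  ∃ s ≤ r, ∀ (n : ℕ) (G : SimpleGraph (Fin n)), InH r s G → IsEmpty (H ↪g G)

/-- `r` is the coloring number `χ_c` of the hereditary property of induced-`H`-free graphs. -/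
def IsColoringNumber {h : ℕ} (H : SimpleGraph (Fin h)) (r : ℕ) : Prop :=
  GoodR H r ∧ ∀ r', GoodR H r' → r' ≤ r

theorem card_functions_few_exceptions {W X : Type*} [Fintype W] [Fintype X] (B : Finset X)
    (K x β : ℕ) (hB : B.card ≤ β) (hβ : 1 ≤ β) (hX : Fintype.card X ≤ x) (hx : 1 ≤ x) :
    Nat.card {τ : W → X // Nat.card {v // τ v ∉ B} ≤ K} ≤
      2 ^ Fintype.card W * x ^ K * β ^ Fintype.card W := by
  classical
  let F : Finset W → Finset (W → X) := fun D ↦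
    Fintype.piFinset fun v ↦ if v ∈ D then Finset.univ else B
  let P : Finset (Finset W) := Finset.univ.filter fun D ↦ D.card ≤ K
  have hsub : (Finset.univ.filter fun τ : W → X ↦ Nat.card {v // τ v ∉ B} ≤ K) ⊆
      P.biUnion F := by
    intro τ hτ
    simp only [Finset.mem_filter, Finset.mem_univ, true_and] at hτ
    rw [Finset.mem_biUnion]
    refine ⟨Finset.univ.filter fun v ↦ τ v ∉ B, ?_, ?_⟩
    · simp only [P, Finset.mem_filter, Finset.mem_univ, true_and]
      rwa [Nat.card_eq_fintype_card, Fintype.card_subtype] at hτ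
    · simp only [F, Fintype.mem_piFinset]
      intro v
      by_cases hv : τ v ∈ B <;> simp [hv]
  have hF : ∀ D ∈ P, (F D).card ≤ x ^ K * β ^ Fintype.card W := by
    intro D hD
    simp only [P, Finset.mem_filter, Finset.mem_univ, true_and] at hD
    have h1 : ∀ v : W, (if v ∈ D then (Finset.univ : Finset X) else B).card ≤
        (if v ∈ D then x else 1) * β := by
      intro v
      split_ifs
      · rw [Finset.card_univ]; nlinarith
      · simpa using hB
    calc (F D).card = ∏ v, (if v ∈ D then (Finset.univ : Finset X) else B).card :=
          Fintype.card_piFinset _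
      _ ≤ ∏ v : W, ((if v ∈ D then x else 1) * β) := Finset.prod_le_prod' fun v _ ↦ h1 v
      _ = x ^ D.card * β ^ Fintype.card W := by
          rw [Finset.prod_mul_distrib, Finset.prod_const, Finset.card_univ]
          simp
      _ ≤ _ := by gcongr
  rw [Nat.card_eq_fintype_card, Fintype.card_subtype]
  calc _ ≤ (P.biUnion F).card := Finset.card_le_card hsub
    _ ≤ P.card * (x ^ K * β ^ Fintype.card W) := Finset.card_biUnion_le_card_mul _ _ _ hF
    _ ≤ 2 ^ Fintype.card W * (x ^ K * β ^ Fintype.card W) := by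
        gcongr
        calc P.card ≤ (Finset.univ : Finset (Finset W)).card := Finset.card_filter_le _ _
          _ = _ := by simp
    _ = _ := by ring

/-- **Ramsey's theorem** for graphs. -/
theorem exists_ramsey (p q : ℕ) : ∃ R : ℕ, ∀ (V : Type) (G : SimpleGraph V) (S : Finset V),
    R ≤ S.card →
      (∃ A ⊆ S, A.card = p ∧ ∀ a ∈ A, ∀ b ∈ A, a ≠ b → G.Adj a b) ∨
      (∃ A ⊆ S, A.card = q ∧ ∀ a ∈ A, ∀ b ∈ A, ¬ G.Adj a b) := by
  classical
  induction p generalizing q with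
  | zero => exact ⟨0, fun V G S _ ↦ .inl ⟨∅, by simp⟩⟩
  | succ p ihp =>
    induction q with
    | zero => exact ⟨0, fun V G S _ ↦ .inr ⟨∅, by simp⟩⟩
    | succ q ihq =>
      obtain ⟨R₁, h₁⟩ := ihp (q + 1)
      obtain ⟨R₂, h₂⟩ := ihq
      refine ⟨R₁ + R₂ + 1, fun V G S hS ↦ ?_⟩
      obtain ⟨v, hv⟩ : S.Nonempty := Finset.card_pos.1 (by omega)
      have hcard : ((S.erase v).filter fun w ↦ G.Adj v w).card +
          ((S.erase v).filter fun w ↦ ¬ G.Adj v w).card + 1 = S.card := by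
        rw [Finset.card_filter_add_card_filter_not, Finset.card_erase_add_one hv]
      have hN : R₁ ≤ ((S.erase v).filter fun w ↦ G.Adj v w).card ∨
          R₂ ≤ ((S.erase v).filter fun w ↦ ¬ G.Adj v w).card := by omega
      rcases hN with hN | hN
      · rcases h₁ V G _ hN with ⟨A, hA, hc, h⟩ | ⟨A, hA, hc, h⟩
        · left
          have hvA : v ∉ A := fun hvA ↦ by simpa using hA hvA
          refine ⟨insert v A, ?_, by rw [Finset.card_insert_of_notMem hvA, hc], ?_⟩
          · intro a ha
            rcases Finset.mem_insert.1 ha with rfl | ha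
            · exact hv
            · exact Finset.mem_of_mem_erase (Finset.mem_filter.1 (hA ha)).1
          · intro a ha b hb hab
            rcases Finset.mem_insert.1 ha with rfl | ha' <;>
            rcases Finset.mem_insert.1 hb with rfl | hb'
            · exact absurd rfl hab
            · exact (Finset.mem_filter.1 (hA hb')).2
            · exact (Finset.mem_filter.1 (hA ha')).2.symm
            · exact h a ha' b hb' hab
        · exact .inr ⟨A, fun a ha ↦ Finset.mem_of_mem_erase (Finset.mem_filter.1 (hA ha)).1, hc, h⟩
      · rcases h₂ V G _ hN with ⟨A, hA, hc, h⟩ | ⟨A, hA, hc, h⟩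
        · exact .inl ⟨A, fun a ha ↦ Finset.mem_of_mem_erase (Finset.mem_filter.1 (hA ha)).1, hc, h⟩
        · right
          have hvA : v ∉ A := fun hvA ↦ by simpa using hA hvA
          refine ⟨insert v A, ?_, by rw [Finset.card_insert_of_notMem hvA, hc], ?_⟩
          · intro a ha
            rcases Finset.mem_insert.1 ha with rfl | ha
            · exact hv
            · exact Finset.mem_of_mem_erase (Finset.mem_filter.1 (hA ha)).1
          · intro a ha b hb
            rcases Finset.mem_insert.1 ha with rfl | ha' <;>
            rcases Finset.mem_insert.1 hb with rfl | hb'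
            · exact G.loopless.irrefl _
            · exact (Finset.mem_filter.1 (hA hb')).2
            · exact fun hab ↦ (Finset.mem_filter.1 (hA ha')).2 hab.symm
            · have hAdj := h a ha' b hb'
              exact hAdj

/-- The classes of `c` are cliques or independent sets of `G`, according to `σ`. -/
def IsHomogeneousColoring {V ι : Type*} (c : V → ι) (σ : ι → Prop) (G : SimpleGraph V) : Prop :=
  ∀ a b, a ≠ b → c a = c b → (G.Adj a b ↔ σ (c a))

theorem exists_homogeneous_coloring (t : ℕ) (ht : 1 ≤ t) : ∃ R : ℕ, ∀ (V : Type) [Fintype V]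
    (G : SimpleGraph V), ∃ (c : V → Fin (Fintype.card V / t + R)) (σ : _ → Prop),
      IsHomogeneousColoring c σ G := by
  classical
  obtain ⟨R, hR⟩ := exists_ramsey t t
  refine ⟨R + t, fun V _ G ↦ ?_⟩
  have key : ∀ (n : ℕ) (S : Finset V), S.card = n → ∃ (c : V → ℕ) (σ : ℕ → Prop),
      (∀ a ∈ S, c a < n / t + (R + t)) ∧
      ∀ a ∈ S, ∀ b ∈ S, a ≠ b → c a = c b → (G.Adj a b ↔ σ (c a)) := by
    intro n
    induction n using Nat.strong_induction_on with
    | _ n ih =>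
      intro S hS
      by_cases hn : R ≤ n ∧ t ≤ n
      · obtain ⟨A, hAS, hA, τ, hτ⟩ : ∃ A ⊆ S, A.card = t ∧ ∃ τ : Prop,
            ∀ a ∈ A, ∀ b ∈ A, a ≠ b → (G.Adj a b ↔ τ) := by
          rcases hR V G S (by omega) with ⟨A, h1, h2, h3⟩ | ⟨A, h1, h2, h3⟩
          · exact ⟨A, h1, h2, True, fun a ha b hb hab ↦ by simp [h3 a ha b hb hab]⟩
          · exact ⟨A, h1, h2, False, fun a ha b hb hab ↦ by simp [h3 a ha b hb]⟩
        obtain ⟨c, σ, hc, hσ⟩ := ih (n - t) (by omega) (S \ A)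
          (by rw [Finset.card_sdiff_of_subset hAS]; omega)
        have hdiv : n / t = (n - t) / t + 1 := by
          rw [← Nat.add_div_right _ (by omega)]
          congr 1; omega
        set m := (n - t) / t + (R + t) with hm
        have hlt : ∀ a ∈ S, a ∉ A → c a < m := fun a ha haA ↦ hc a (by simp [ha, haA])
        refine ⟨fun v ↦ if v ∈ A then m else c v, fun i ↦ if i = m then τ else σ i, ?_, ?_⟩
        · intro a ha
          by_cases haA : a ∈ A
          · simp only [haA, if_true]; omega
          · have := hlt a ha haA
            simp only [haA, if_false]; omega
        · intro a ha b hb hab hcab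
          by_cases haA : a ∈ A <;> by_cases hbA : b ∈ A <;>
            simp only [haA, hbA, if_true, if_false] at hcab ⊢
          · exact hτ a haA b hbA hab
          · have := hlt b hb hbA; omega
          · have := hlt a ha haA; omega
          · have := hlt a ha haA
            rw [if_neg (by omega)]
            exact hσ a (by simp [ha, haA]) b (by simp [hb, hbA]) hab hcab
      · refine ⟨fun v ↦ if hv : v ∈ S then S.equivFin ⟨v, hv⟩ else 0, fun _ ↦ True, ?_, ?_⟩
        · intro a ha
          simp only [ha, dif_pos]
          have h1 := (S.equivFin ⟨a, ha⟩).2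
          have h2 : n ≤ n / t + (R + t) := by
            have := Nat.zero_le (n / t)
            omega
          omega
        · intro a ha b hb hab hcab
          simp only [ha, hb, dif_pos] at hcab
          have := S.equivFin.injective (Fin.ext hcab)
          exact absurd (by simpa using this) hab
  obtain ⟨c, σ, hc, hσ⟩ := key _ Finset.univ rfl
  refine ⟨fun v ↦ ⟨c v, hc v (Finset.mem_univ v)⟩, fun i ↦ σ i, fun a b hab hcab ↦ ?_⟩
  exact hσ a (Finset.mem_univ a) b (Finset.mem_univ b) hab (congrArg Fin.val hcab)

/-- `F` contains a complete `r`-partite graph with parts of size `T`, each of which is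
monochromatic under `c`. -/
def HasBlowup {V ι : Type*} (r T : ℕ) (c : V → ι) (F : SimpleGraph V) : Prop :=
  ∃ e : Fin r → Fin T ↪ V, (∀ i a b, c (e i a) = c (e i b)) ∧
    ∀ i j a b, i ≠ j → F.Adj (e i a) (e j b)

theorem card_simpleGraph_le (V : Type) [Fintype V] :
    Nat.card (SimpleGraph V) ≤ 2 ^ (Fintype.card V ^ 2) := by
  classical
  have : Function.Injective (fun F : SimpleGraph V ↦ {p : V × V | F.Adj p.1 p.2}) := by
    intro F F' h
    ext a b
    exact Set.ext_iff.1 h (a, b)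
  refine (Nat.card_le_card_of_injective _ this).trans ?_
  simp [Nat.card_eq_fintype_card, sq]

theorem HasBlowup.of_common_trace {V : Type} {ι : Type*} {r T T' : ℕ} {c : V → ι}
    {F : SimpleGraph V}
    (e : Fin r → Fin T' ↪ V) (hmono : ∀ i a b, c (e i a) = c (e i b))
    (hadj : ∀ i j a b, i ≠ j → F.Adj (e i a) (e j b)) (A : Finset V) (hA : T ≤ A.card)
    (hAc : ∀ v ∈ A, ∀ w ∈ A, c v = c w) (X : Fin r → Finset (Fin T')) (hX : ∀ i, T ≤ (X i).card)
    (hAX : ∀ v ∈ A, ∀ i, ∀ a ∈ X i, F.Adj v (e i a)) : HasBlowup (r + 1) T c F := by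
  have hex : ∀ {α : Type} (S : Finset α), T ≤ S.card → ∃ f : Fin T ↪ α, ∀ a, f a ∈ S := by
    intro α S hS
    obtain ⟨f⟩ : Nonempty (Fin T ↪ S) :=
      Function.Embedding.nonempty_of_card_le (by simpa using hS)
    exact ⟨f.trans (Function.Embedding.subtype _), fun a ↦ (f a).2⟩
  obtain ⟨w, hw⟩ := hex A hA
  choose f hf using fun i ↦ hex (X i) (hX i)
  refine ⟨Fin.cons w fun i ↦ (f i).trans (e i), ?_, ?_⟩
  · intro i
    refine Fin.cases ?_ (fun i ↦ ?_) i
    · exact fun a b ↦ hAc _ (hw a) _ (hw b)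
    · exact fun a b ↦ hmono _ _ _
  · intro i j a b
    refine Fin.cases ?_ (fun i ↦ ?_) i <;> refine Fin.cases ?_ (fun j ↦ ?_) j
    · exact fun h ↦ absurd rfl h
    · exact fun _ ↦ hAX _ (hw a) j _ (hf j b)
    · exact fun _ ↦ (hAX _ (hw b) i _ (hf i a)).symm
    · exact fun h ↦ hadj i j _ _ fun hij ↦ h (by rw [hij])

theorem card_rich_traces_le {V : Type} [Fintype V] {k r T T' : ℕ} {c : V → Fin k}
    {F : SimpleGraph V} (hF : ¬ HasBlowup (r + 1) T c F)
    (e : Fin r → Fin T' ↪ V) (hmono : ∀ i a b, c (e i a) = c (e i b))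
    (hadj : ∀ i j a b, i ≠ j → F.Adj (e i a) (e j b)) (D : Finset V)
    (τ : V → Fin r → Finset (Fin T')) (hτ : ∀ v ∈ D, ∀ i a, a ∈ τ v i ↔ F.Adj v (e i a))
    (hD : ∀ v ∈ D, ∀ i, T ≤ (τ v i).card) : D.card ≤ k * 2 ^ (r * T') * T := by
  classical
  by_contra! hlt
  obtain ⟨⟨j, X⟩, -, hy⟩ := Finset.exists_lt_card_fiber_of_mul_lt_card_of_maps_to (s := D)
    (t := (Finset.univ : Finset (Fin k × (Fin r → Finset (Fin T'))))) (f := fun v ↦ (c v, τ v))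
    (n := T) (fun _ _ ↦ Finset.mem_univ _) (by
      refine lt_of_eq_of_lt ?_ hlt
      simp [← pow_mul, mul_comm])
  refine hF (HasBlowup.of_common_trace e hmono hadj _ hy.le ?_ X ?_ ?_)
  · intro v hv w hw
    simp only [Finset.mem_filter, Prod.mk.injEq] at hv hw
    rw [hv.2.1, hw.2.1]
  · intro i
    obtain ⟨v, hv⟩ := Finset.card_pos.1 (Nat.zero_lt_of_lt hy)
    simp only [Finset.mem_filter, Prod.mk.injEq] at hv
    rw [← hv.2.2]
    exact hD v hv.1 i
  · intro v hv i a ha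
    simp only [Finset.mem_filter, Prod.mk.injEq] at hv
    rw [← hv.2.2] at ha
    exact (hτ v hv.1 i a).1 ha

theorem card_blowupFree_le {V : Type} [Fintype V] (k r T T' β N : ℕ) (c : V → Fin k)
    (hβ : 1 ≤ β)
    (hB : Nat.card {X : Fin r → Finset (Fin T') // ∃ i, (X i).card < T} ≤ β)
    (hN : ∀ p : V → Prop, Nat.card {v // p v} + r * T' = Fintype.card V →
      Nat.card {F : SimpleGraph {v // p v} //
        ¬ HasBlowup (r + 1) T (fun v : {v // p v} ↦ c v) F} ≤ N) :
    Nat.card {F : SimpleGraph V // ¬ HasBlowup (r + 1) T c F} ≤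
      Nat.card {F : SimpleGraph V // ¬ HasBlowup r T' c F} +
      Fintype.card V ^ (r * T') * (2 ^ ((r * T') ^ 2) * (2 ^ (Fintype.card V - r * T') *
        (2 ^ (r * T')) ^ (k * 2 ^ (r * T') * T) * β ^ (Fintype.card V - r * T')) * N) := by
  classical
  set Q := 2 ^ ((r * T') ^ 2) * (2 ^ (Fintype.card V - r * T') *
        (2 ^ (r * T')) ^ (k * 2 ^ (r * T') * T) * β ^ (Fintype.card V - r * T')) * N with hQ
  let S : (Fin r → Fin T' ↪ V) → Finset (SimpleGraph V) := fun e ↦ Finset.univ.filter fun F ↦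
    ¬ HasBlowup (r + 1) T c F ∧ (∀ i a b, c (e i a) = c (e i b)) ∧
    ∀ i j a b, i ≠ j → F.Adj (e i a) (e j b)
  have hsub : (Finset.univ.filter fun F : SimpleGraph V ↦ ¬ HasBlowup (r + 1) T c F) ⊆
      (Finset.univ.filter fun F : SimpleGraph V ↦ ¬ HasBlowup r T' c F) ∪
        Finset.univ.biUnion S := by
    intro F hF
    simp only [Finset.mem_filter, Finset.mem_univ, true_and] at hF
    by_cases h : HasBlowup r T' c F
    · obtain ⟨e, h1, h2⟩ := h
      refine Finset.mem_union_right _ (Finset.mem_biUnion.2 ⟨e, Finset.mem_univ e, ?_⟩)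
      simp only [S, Finset.mem_filter, Finset.mem_univ, true_and]
      exact ⟨hF, h1, h2⟩
    · exact Finset.mem_union_left _ (by simpa using h)
  have hS : ∀ e ∈ Finset.univ, (S e).card ≤ Q := by
    intro e _
    rcases (S e).eq_empty_or_nonempty with h0 | ⟨F₀, hF₀⟩
    · simp [h0]
    simp only [S, Finset.mem_filter, Finset.mem_univ, true_and] at hF₀
    let E : Fin r × Fin T' → V := fun x ↦ e x.1 x.2
    have hE : Function.Injective E := by
      rintro ⟨i, a⟩ ⟨j, b⟩ h
      by_cases hij : i = j
      · subst hij
        exact Prod.ext rfl ((e i).injective h)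
      · exact absurd h (hF₀.2.2 i j a b hij).ne
    let p : V → Prop := fun v ↦ v ∉ Set.range E
    have hp : Nat.card {v // p v} + r * T' = Fintype.card V := by
      rw [Nat.card_eq_fintype_card, Fintype.card_subtype_compl]
      have h1 : Fintype.card {x // x ∈ Set.range E} = r * T' := by
        rw [← Fintype.card_congr (Equiv.ofInjective E hE)]
        simp
      have h2 := Fintype.card_subtype_le (fun x ↦ x ∈ Set.range E)
      omega
    let B : Finset (Fin r → Finset (Fin T')) := Finset.univ.filter fun X ↦ ∃ i, (X i).card < T
    have hBc : B.card ≤ β := by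
      rwa [Nat.card_eq_fintype_card, Fintype.card_subtype] at hB
    let tr : SimpleGraph V → {v // p v} → Fin r → Finset (Fin T') := fun F v i ↦
      Finset.univ.filter fun a ↦ F.Adj v (e i a)
    let K := k * 2 ^ (r * T') * T
    have htr : ∀ F ∈ S e, Nat.card {v // tr F v ∉ B} ≤ K := by
      intro F hF
      simp only [S, Finset.mem_filter, Finset.mem_univ, true_and] at hF
      have := card_rich_traces_le hF.1 e hF.2.1 hF.2.2
        ((Finset.univ.filter fun v ↦ tr F v ∉ B).map (Function.Embedding.subtype p))
        (fun v i ↦ Finset.univ.filter fun a ↦ F.Adj v (e i a)) (by simp) (by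
          intro v hv
          simp only [Finset.mem_map, Finset.mem_filter, Finset.mem_univ, true_and, B, tr] at hv
          obtain ⟨w, hw, rfl⟩ := hv
          push Not at hw
          exact hw)
      rw [Finset.card_map] at this
      rw [Nat.card_eq_fintype_card, Fintype.card_subtype]
      exact this
    have hind : ∀ F ∈ S e, ¬ HasBlowup (r + 1) T (fun v : {v // p v} ↦ c v)
        (F.comap (Subtype.val : {v // p v} → V)) := by
      intro F hF
      simp only [S, Finset.mem_filter, Finset.mem_univ, true_and] at hF
      rintro ⟨f, h1, h2⟩
      exact hF.1 ⟨fun i ↦ (f i).trans (Function.Embedding.subtype p), h1, h2⟩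
    let Φ : {F // F ∈ S e} → SimpleGraph (Fin r × Fin T') ×
        {τ : {v // p v} → Fin r → Finset (Fin T') // Nat.card {v // τ v ∉ B} ≤ K} ×
        {F : SimpleGraph {v // p v} //
          ¬ HasBlowup (r + 1) T (fun v : {v // p v} ↦ c v) F} := fun F ↦
      (F.1.comap E, ⟨tr F.1, htr _ F.2⟩, ⟨F.1.comap Subtype.val, hind _ F.2⟩)
    have hΦ : Function.Injective Φ := by
      rintro ⟨F, hF⟩ ⟨F', hF'⟩ h
      simp only [Φ, Prod.mk.injEq, Subtype.mk.injEq] at h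
      obtain ⟨h1, h2, h3⟩ := h
      have h12 : ∀ x v, p v → (F.Adj v (E x) ↔ F'.Adj v (E x)) := by
        intro x v hv
        have := congrFun (congrFun h2 ⟨v, hv⟩) x.1
        have := Finset.ext_iff.1 this x.2
        simpa [tr] using this
      rw [Subtype.mk.injEq]
      ext v w
      by_cases hv : p v <;> by_cases hw : p w
      · have := congrArg (fun G ↦ G.Adj ⟨v, hv⟩ ⟨w, hw⟩) h3
        simpa using this
      · simp only [p, not_not] at hw
        obtain ⟨x, rfl⟩ := hw
        exact h12 x v hv
      · simp only [p, not_not] at hv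
        obtain ⟨x, rfl⟩ := hv
        rw [F.adj_comm, F'.adj_comm]
        exact h12 x w hw
      · simp only [p, not_not] at hv hw
        obtain ⟨x, rfl⟩ := hv
        obtain ⟨y, rfl⟩ := hw
        have := congrArg (fun G ↦ G.Adj x y) h1
        simpa using this
    have hw : Fintype.card {v // p v} = Fintype.card V - r * T' := by
      rw [Nat.card_eq_fintype_card] at hp; omega
    have h1 := Nat.card_le_card_of_injective Φ hΦ
    rw [Nat.card_prod, Nat.card_prod, Nat.card_eq_fintype_card, Fintype.card_coe] at h1
    refine h1.trans ?_
    rw [hQ, mul_assoc (2 ^ ((r * T') ^ 2))]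
    have h2 := card_simpleGraph_le (Fin r × Fin T')
    have h3 := card_functions_few_exceptions (W := {v // p v}) B K (2 ^ (r * T')) β hBc hβ
      (by simp [← pow_mul, mul_comm]) Nat.one_le_two_pow
    rw [hw] at h3
    simp only [Fintype.card_prod, Fintype.card_fin] at h2
    exact Nat.mul_le_mul h2 (Nat.mul_le_mul h3 (hN p hp))
  rw [Nat.card_eq_fintype_card, Nat.card_eq_fintype_card, Fintype.card_subtype,
    Fintype.card_subtype]
  refine (Finset.card_le_card hsub).trans ((Finset.card_union_le _ _).trans ?_)
  gcongr
  refine (Finset.card_biUnion_le_card_mul _ _ _ hS).trans ?_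
  gcongr
  rw [Finset.card_univ, Fintype.card_fun, Fintype.card_fin, mul_comm, pow_mul]
  gcongr
  rw [Fintype.card_embedding_eq, Fintype.card_fin]
  exact Nat.descFactorial_le_pow _ _

theorem card_poor_traces_le (r T t : ℕ) :
    Nat.card {X : Fin (r + 1) → Finset (Fin t) // ∃ i, (X i).card < T} ≤
      (r + 1) * (T * (t + 1) ^ T * 2 ^ (r * t)) := by
  classical
  let B : Finset (Finset (Fin t)) := (Finset.range T).biUnion fun j ↦
    Finset.powersetCard j Finset.univ
  have hB : B.card ≤ T * (t + 1) ^ T := by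
    refine (Finset.card_biUnion_le_card_mul _ _ ((t + 1) ^ T) fun j hj ↦ ?_).trans (by simp)
    rw [Finset.card_powersetCard, Finset.card_univ, Fintype.card_fin]
    calc t.choose j ≤ t ^ j := Nat.choose_le_pow _ _
      _ ≤ (t + 1) ^ j := by gcongr; omega
      _ ≤ (t + 1) ^ T := by
        gcongr
        · omega
        · exact (Finset.mem_range.1 hj).le
  let S : Fin (r + 1) → Finset (Fin (r + 1) → Finset (Fin t)) := fun i ↦
    Fintype.piFinset fun j ↦ if j = i then B else Finset.univ
  have hS : ∀ i ∈ Finset.univ, (S i).card ≤ T * (t + 1) ^ T * 2 ^ (r * t) := by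
    intro i _
    rw [Fintype.card_piFinset, ← Finset.mul_prod_erase Finset.univ _ (Finset.mem_univ i)]
    simp only [if_true]
    gcongr
    rw [Finset.prod_congr rfl (g := fun _ ↦ 2 ^ t), Finset.prod_const]
    · rw [Finset.card_erase_of_mem (Finset.mem_univ i)]
      simp [← pow_mul, mul_comm]
    · intro j hj
      rw [if_neg (Finset.ne_of_mem_erase hj)]
      simp
  rw [Nat.card_eq_fintype_card, Fintype.card_subtype]
  refine (Finset.card_le_card (t := Finset.univ.biUnion S) ?_).trans
    ((Finset.card_biUnion_le_card_mul _ _ _ hS).trans (by simp))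
  intro X hX
  simp only [Finset.mem_filter, Finset.mem_univ, true_and] at hX
  obtain ⟨i, hi⟩ := hX
  refine Finset.mem_biUnion.2 ⟨i, Finset.mem_univ i, ?_⟩
  simp only [S, Fintype.mem_piFinset]
  intro j
  split_ifs with h
  · subst h
    exact Finset.mem_biUnion.2 ⟨_, Finset.mem_range.2 hi, by simp⟩
  · exact Finset.mem_univ _

theorem exists_le_two_rpow (δ : ℝ) (hδ : 0 < δ) : ∃ D : ℝ, 0 ≤ D ∧ ∀ n : ℕ,
    (n : ℝ) ≤ 2 ^ (δ * n + D) := by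
  refine ⟨max 0 (Real.logb 2 (1 / δ)), le_max_left _ _, fun n ↦ ?_⟩
  have h1 : δ * n ≤ 2 ^ (δ * n) := by
    have h2 := Real.add_one_le_exp (δ * n * Real.log 2)
    have h3 : ∀ x : ℝ, 0 ≤ x → x ≤ 2 ^ x := by
      intro x hx
      have h4 := one_add_mul_self_le_rpow_one_add (s := 1) (by norm_num) (p := max x 1)
        (le_max_right _ _)
      rcases le_total x 1 with h | h
      · exact h.trans (Real.one_le_rpow (by norm_num) hx)
      · rw [max_eq_left h] at h4
        norm_num at h4
        linarith
    exact h3 _ (by positivity)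
  rw [Real.rpow_add (by norm_num)]
  have h5 : 1 / δ ≤ (2 : ℝ) ^ max 0 (Real.logb 2 (1 / δ)) := by
    calc 1 / δ = (2 : ℝ) ^ Real.logb 2 (1 / δ) :=
          (Real.rpow_logb (by norm_num) (by norm_num) (by positivity)).symm
      _ ≤ _ := Real.rpow_le_rpow_of_exponent_le (by norm_num) (le_max_right _ _)
  calc (n : ℝ) = δ * n * (1 / δ) := by field_simp
    _ ≤ _ := by gcongr

theorem exists_poor_traces_bound (r T : ℕ) (ε : ℝ) (hε : 0 < ε) : ∃ t β : ℕ, 1 ≤ t ∧ 1 ≤ β ∧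
    Nat.card {X : Fin (r + 1) → Finset (Fin t) // ∃ i, (X i).card < T} ≤ β ∧
    2 * (β : ℝ) ≤ 2 ^ (((r : ℝ) / (r + 1) + ε) * ((r + 1) * t)) := by
  have hlim := tendsto_pow_const_div_const_pow_of_one_lt T
    (Real.one_lt_rpow (x := 2) (z := ε) (by norm_num) hε)
  have hK : (0 : ℝ) < 1 / (2 * ((r + 1) * T + 1) * 2 ^ T) := by positivity
  obtain ⟨t, ht, ht1⟩ := ((hlim.eventually (gt_mem_nhds hK)).and
    (Filter.eventually_ge_atTop 1)).exists
  refine ⟨t, (r + 1) * (T * (t + 1) ^ T * 2 ^ (r * t)) + 1, ht1, by omega,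
    (card_poor_traces_le r T t).trans (by omega), ?_⟩
  have hpos : (0 : ℝ) < (2 ^ ε) ^ t := by positivity
  rw [div_lt_iff₀ hpos, div_mul_eq_mul_div, one_mul, lt_div_iff₀ (by positivity)] at ht
  have e1 : (2 : ℝ) ^ (((r : ℝ) / (r + 1) + ε) * ((r + 1) * t)) =
      2 ^ (r * t) * ((2 : ℝ) ^ (ε * t)) ^ (r + 1) := by
    rw [← Real.rpow_natCast, ← Real.rpow_natCast, ← Real.rpow_mul (by norm_num),
      ← Real.rpow_add (by norm_num)]
    congr 1
    push_cast
    field_simp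
  have e2 : ((2 : ℝ) ^ ε) ^ t = 2 ^ (ε * t) := by
    rw [← Real.rpow_natCast, ← Real.rpow_mul (by norm_num)]
  have e3 : (1 : ℝ) ≤ 2 ^ (ε * t) := Real.one_le_rpow (by norm_num) (by positivity)
  have e4 : (2 : ℝ) ^ (ε * t) ≤ ((2 : ℝ) ^ (ε * t)) ^ (r + 1) := le_self_pow₀ e3 (by omega)
  have e5 : ((t : ℝ) + 1) ^ T ≤ t ^ T * 2 ^ T := by
    rw [← mul_pow]
    gcongr
    have : (1 : ℝ) ≤ t := by exact_mod_cast ht1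
    linarith
  have e6 : (1 : ℝ) ≤ ((t : ℝ) + 1) ^ T := one_le_pow₀ (by linarith [Nat.cast_nonneg (α := ℝ) t])
  have e7 : (1 : ℝ) ≤ 2 ^ (r * t) := one_le_pow₀ (by norm_num)
  rw [e1]
  rw [e2] at ht
  push_cast
  calc 2 * (((r : ℝ) + 1) * (T * (t + 1) ^ T * 2 ^ (r * t)) + 1)
      ≤ 2 * (((r : ℝ) + 1) * (T * (t + 1) ^ T * 2 ^ (r * t)) + (t + 1) ^ T * 2 ^ (r * t)) := by
        gcongr
        nlinarith
    _ = 2 ^ (r * t) * (2 * ((r + 1) * T + 1) * (t + 1) ^ T) := by ring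
    _ ≤ 2 ^ (r * t) * (2 * ((r + 1) * T + 1) * (t ^ T * 2 ^ T)) := by gcongr
    _ ≤ 2 ^ (r * t) * 2 ^ (ε * t) := by
        gcongr
        linarith
    _ ≤ _ := by gcongr

theorem card_blowupFree_one_le {V : Type} [Fintype V] (k T : ℕ) (c : V → Fin k) :
    Nat.card {F : SimpleGraph V // ¬ HasBlowup 1 T c F} ≤ 2 ^ (T * Fintype.card V * k) := by
  classical
  by_cases h : k * T < Fintype.card V
  · have : IsEmpty {F : SimpleGraph V // ¬ HasBlowup 1 T c F} := by
      refine ⟨fun ⟨F, hF⟩ ↦ ?_⟩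
      obtain ⟨j, -, hj⟩ := Finset.exists_lt_card_fiber_of_mul_lt_card_of_maps_to
        (s := (Finset.univ : Finset V)) (t := (Finset.univ : Finset (Fin k))) (f := c)
        (n := T) (fun _ _ ↦ Finset.mem_univ _) (by simpa using h)
      refine hF (HasBlowup.of_common_trace (T' := T) (r := 0) (fun i ↦ i.elim0) (fun i ↦ i.elim0)
        (fun i ↦ i.elim0) _ hj.le ?_ (fun i ↦ i.elim0) (fun i ↦ i.elim0) (fun _ _ i ↦ i.elim0))
      intro v hv w hw
      simp only [Finset.mem_filter, Finset.mem_univ, true_and] at hv hw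
      rw [hv, hw]
    simp
  · refine (Finite.card_subtype_le _).trans ((card_simpleGraph_le V).trans ?_)
    gcongr
    · norm_num
    · nlinarith

theorem exists_card_blowupFree_le (r : ℕ) : ∀ (T : ℕ) (ε : ℝ), 0 < ε → ∃ C : ℝ, 0 ≤ C ∧
    ∀ (V : Type) [Fintype V] (k : ℕ) (c : V → Fin k),
      (Nat.card {F : SimpleGraph V // ¬ HasBlowup (r + 1) T c F} : ℝ) ≤
        2 ^ ((((r : ℝ) - 1) / r + ε) * (Fintype.card V : ℝ) ^ 2 / 2 + C * Fintype.card V * k) := by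
  classical
  induction r with
  | zero =>
    intro T ε hε
    refine ⟨T, by positivity, fun V _ k c ↦ ?_⟩
    have h1 : (Nat.card {F : SimpleGraph V // ¬ HasBlowup 1 T c F} : ℝ) ≤
        2 ^ (T * Fintype.card V * k) := by exact_mod_cast card_blowupFree_one_le k T c
    refine h1.trans ?_
    rw [← Real.rpow_natCast]
    refine Real.rpow_le_rpow_of_exponent_le (by norm_num) ?_
    push_cast
    have : 0 ≤ ε * (Fintype.card V : ℝ) ^ 2 := by positivity
    simp only [div_zero]
    linarith
  | succ r ih =>
    intro T ε hε
    obtain ⟨t, β, ht, hβ, hB, hβ2⟩ := exists_poor_traces_bound r T (ε / 2) (by positivity)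
    obtain ⟨C', hC', hfree⟩ := ih t ε hε
    obtain ⟨D, hD, hn⟩ := exists_le_two_rpow (ε / 2) (by positivity)
    set u := (r + 1) * t with hu
    set M := 2 ^ u * T with hM
    set C : ℝ := C' + 2 + D + u + M with hC
    have hu1 : 1 ≤ u := by rw [hu]; exact Nat.mul_pos (by omega) ht
    refine ⟨C, by positivity, fun V _ k c ↦ ?_⟩
    induction hcard : Fintype.card V using Nat.strong_induction_on generalizing V with
    | _ n ihn =>
      set a : ℝ := (r : ℝ) / (r + 1) with ha
      have ha0 : 0 ≤ a := by positivity
      have ha1 : (((r + 1 : ℕ) : ℝ) - 1) / ((r + 1 : ℕ) : ℝ) = a := by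
        push_cast
        rw [ha]
        congr 1
        ring
      have ha2 : ((r : ℝ) - 1) / r ≤ a := by
        rw [ha]
        rcases Nat.eq_zero_or_pos r with rfl | hr
        · simp
        · have : (0 : ℝ) < r := by exact_mod_cast hr
          rw [div_le_div_iff₀ this (by positivity)]
          nlinarith
      rw [ha1] at ihn ⊢
      rcases Nat.eq_zero_or_pos n with rfl | hn0
      · have : IsEmpty V := Fintype.card_eq_zero_iff.1 hcard
        simp
      have hk : 1 ≤ k := by
        obtain ⟨v⟩ := Fintype.card_pos_iff.1 (hcard ▸ hn0)
        exact (Nat.zero_le _).trans_lt (c v).2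
      have hk' : (1 : ℝ) ≤ k := by exact_mod_cast hk
      have hn0' : (1 : ℝ) ≤ n := by exact_mod_cast hn0
      set Φ : ℝ := (a + ε) * (n : ℝ) ^ 2 / 2 + C * n * k with hΦ
      have hx : (Nat.card {F : SimpleGraph V // ¬ HasBlowup (r + 1) t c F} : ℝ) ≤ 2 ^ (Φ - 1) := by
        refine (hfree V k c).trans (Real.rpow_le_rpow_of_exponent_le (by norm_num) ?_)
        rw [hcard, hΦ]
        have h1 : (((r : ℝ) - 1) / r) * (n : ℝ) ^ 2 ≤ a * (n : ℝ) ^ 2 := by gcongr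
        have h2 : (1 : ℝ) ≤ n * k := by nlinarith
        have h3 : C' * (n * k) + 1 ≤ C * (n * k) := by
          have : (0 : ℝ) ≤ (1 + D + u + M) * (n * k) := by positivity
          rw [hC]; linarith
        linarith
      have hsplit : (2 : ℝ) ^ (Φ - 1) + 2 ^ (Φ - 1) = 2 ^ Φ := by
        rw [← two_mul, Real.rpow_sub (by norm_num), Real.rpow_one]; ring
      by_cases hun : n < u
      · have := card_blowupFree_le k (r + 1) T t β 0 c hβ hB (by
          intro p hp
          omega)
        simp only [mul_zero, add_zero] at this
        calc _ ≤ (Nat.card {F : SimpleGraph V // ¬ HasBlowup (r + 1) t c F} : ℝ) := by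
              exact_mod_cast this
          _ ≤ _ := by
            have : (0 : ℝ) < 2 ^ (Φ - 1) := by positivity
            linarith
      push Not at hun
      obtain ⟨w, rfl⟩ := Nat.exists_eq_add_of_le' hun
      set Ψ : ℝ := (a + ε) * (w : ℝ) ^ 2 / 2 + C * w * k with hΨ
      have hrec := card_blowupFree_le k (r + 1) T t β ⌊(2 : ℝ) ^ Ψ⌋₊ c hβ hB (by
        intro p hp
        have hp' : Fintype.card {v // p v} = w := by
          rw [Nat.card_eq_fintype_card] at hp; omega
        refine Nat.le_floor ?_
        exact ihn w (by omega) {v // p v} inferInstance (fun v ↦ c v) hp')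
      rw [hcard, ← hu, Nat.add_sub_cancel] at hrec
      have hy : ((w + u : ℕ) : ℝ) ^ u * (2 ^ (u ^ 2) * (2 ^ w * (2 ^ u) ^ (k * 2 ^ u * T) * β ^ w) *
          ⌊(2 : ℝ) ^ Ψ⌋₊) ≤ 2 ^ (Φ - 1) := by
        calc _ ≤ ((2 : ℝ) ^ (ε / 2 * ((w + u : ℕ) : ℝ) + D)) ^ u *
              (2 ^ (u ^ 2) * ((2 ^ u) ^ (k * M) * (2 * β) ^ w) * 2 ^ Ψ) := by
              have e1 := hn (w + u)
              have e2 := Nat.floor_le (show (0 : ℝ) ≤ (2 : ℝ) ^ Ψ by positivity)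
              have e3 : (2 : ℝ) ^ w * (2 ^ u) ^ (k * 2 ^ u * T) * β ^ w =
                  (2 ^ u) ^ (k * M) * (2 * β) ^ w := by
                rw [hM, mul_pow, mul_assoc k]; ring
              rw [e3]
              gcongr
          _ ≤ ((2 : ℝ) ^ (ε / 2 * ((w + u : ℕ) : ℝ) + D)) ^ u *
              (2 ^ (u ^ 2) * ((2 ^ u) ^ (k * M) * (2 ^ ((a + ε / 2) * u)) ^ w) * 2 ^ Ψ) := by
              have : 2 * (β : ℝ) ≤ 2 ^ ((a + ε / 2) * u) := by
                rw [hu]; push_cast; exact hβ2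
              gcongr
          _ = 2 ^ ((ε / 2 * (w + u) + D) * u + ((u : ℝ) * u + (u * (k * M) + (a + ε / 2) * u * w)
              + Ψ)) := by
              simp only [← Real.rpow_natCast, ← Real.rpow_mul (show (0 : ℝ) ≤ 2 by norm_num),
                ← Real.rpow_add (show (0 : ℝ) < 2 by norm_num)]
              congr 1
              push_cast
              ring
          _ ≤ 2 ^ (Φ - 1) := by
              refine Real.rpow_le_rpow_of_exponent_le (by norm_num) ?_
              rw [hΦ, hΨ]
              push_cast
              have hu1' : (1 : ℝ) ≤ u := by exact_mod_cast hu1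
              have huk : (u : ℝ) ≤ u * k := by nlinarith
              have g1 : D * u ≤ D * (u * k) := by gcongr
              have g2 : (u : ℝ) * u ≤ u * (u * k) := by gcongr
              have g3 : 0 ≤ C' * (u * k) := by positivity
              have g4 : 0 ≤ a * (u : ℝ) ^ 2 := by positivity
              have g5 : C * (u * k) = C' * (u * k) + 2 * (u * k) + D * (u * k) + u * (u * k)
                + M * (u * k) := by rw [hC]; ring
              have g6 : (1 : ℝ) ≤ u * k := by linarith
              nlinarith
      have hrec' := (Nat.cast_le (α := ℝ)).2 hrec
      push_cast at hrec' hy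
      linarith

theorem inH_of_not_goodR {h r : ℕ} {H : SimpleGraph (Fin h)} (hr : ¬ GoodR H r) (s : ℕ)
    (hs : s ≤ r) : InH r s H := by
  by_contra hH
  refine hr ⟨s, hs, fun n G ⟨f, h1, h2⟩ ↦ ⟨fun φ ↦ hH ⟨f ∘ φ, ?_, ?_⟩⟩⟩
  · intro i hi a b ha hb hab
    exact φ.map_adj_iff.1 (h1 i hi _ _ ha hb fun h ↦ hab (φ.injective h))
  · intro i hi a b ha hb hab
    exact h2 i hi _ _ ha hb (φ.map_adj_iff.2 hab)

theorem exists_coloring_of_not_goodR {h r : ℕ} {H : SimpleGraph (Fin h)} (hr : ¬ GoodR H r)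
    (P : Fin r → Prop) : ∃ f : Fin h → Fin r,
      ∀ x y, x ≠ y → f x = f y → (H.Adj x y ↔ P (f x)) := by
  classical
  let s := (Finset.univ.filter P).card
  have hs : s ≤ r := (Finset.card_filter_le _ _).trans (by simp)
  have hcard : Fintype.card {i // P i} = Fintype.card {i : Fin r // (i : ℕ) < s} := by
    rw [Fintype.card_subtype, Fintype.card_subtype]
    change s = _
    rw [Fin.card_filter_val_lt]
    simpa using hs
  let π : Equiv.Perm (Fin r) := (Fintype.equivOfCardEq hcard).extendSubtype
  have hπ : ∀ i, P i ↔ (π i : ℕ) < s := by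
    intro i
    constructor
    · exact fun hi ↦ (Fintype.equivOfCardEq hcard).extendSubtype_mem i hi
    · intro h'
      by_contra hi
      exact (Fintype.equivOfCardEq hcard).extendSubtype_not_mem i hi h'
  obtain ⟨f, h1, h2⟩ := inH_of_not_goodR hr s hs
  refine ⟨fun x ↦ π.symm (f x), fun x y hxy hf ↦ ?_⟩
  have hf' : f x = f y := π.symm.injective hf
  rw [hπ, Equiv.apply_symm_apply]
  constructor
  · intro hadj
    by_contra hlt
    exact h2 (f x) (not_lt.1 hlt) x y rfl hf'.symm hadj
  · exact fun hlt ↦ h1 (f x) hlt x y rfl hf'.symm hxy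

theorem card_free_homogeneous_le {h r k : ℕ} {H : SimpleGraph (Fin h)} (hr : ¬ GoodR H r)
    {V : Type} [Fintype V] (c : V → Fin k) (σ : Fin k → Prop) :
    Nat.card {G : SimpleGraph V // IsEmpty (H ↪g G) ∧ IsHomogeneousColoring c σ G} ≤
      Nat.card {F : SimpleGraph V // ¬ HasBlowup r h c F} := by
  classical
  let P : Finset (SimpleGraph V) := Finset.univ.filter fun G ↦
    IsEmpty (H ↪g G) ∧ IsHomogeneousColoring c σ G
  let 𝒜 : Finset (Finset (Sym2 V)) := P.image fun G ↦ G.edgeFinset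
  have h𝒜 : P.card = 𝒜.card := by
    refine (Finset.card_image_of_injective _ fun G G' hG ↦ ?_).symm
    exact edgeFinset_inj.1 hG
  have hdiag : ∀ X, 𝒜.Shatters X → ∀ p ∈ X, ¬ p.IsDiag := by
    intro X hX p hp
    obtain ⟨u, hu, hXu⟩ := hX.exists_superset
    obtain ⟨G, -, rfl⟩ := Finset.mem_image.1 hu
    exact G.not_isDiag_of_mem_edgeFinset (hXu hp)
  have hadj : ∀ X, 𝒜.Shatters X → ∀ a b,
      (fromEdgeSet (X : Set (Sym2 V))).Adj a b ↔ s(a, b) ∈ X := by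
    intro X hX a b
    rw [fromEdgeSet_adj]
    exact ⟨fun hab ↦ hab.1, fun hab ↦ ⟨hab, fun h ↦ hdiag X hX _ hab (by simpa using h)⟩⟩
  have hblow : ∀ X, 𝒜.Shatters X → ¬ HasBlowup r h c (fromEdgeSet (X : Set (Sym2 V))) := by
    rintro X hX ⟨e, hmono, hcross⟩
    have hcross' : ∀ i j a b, i ≠ j → s(e i a, e j b) ∈ X := fun i j a b hij ↦
      (hadj X hX _ _).1 (hcross i j a b hij)
    obtain ⟨f, hf⟩ := exists_coloring_of_not_goodR hr fun i ↦ ∃ a, σ (c (e i a))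
    let g : Fin h → V := fun x ↦ e (f x) x
    have hg : Function.Injective g := by
      intro x y hxy
      by_cases hfxy : f x = f y
      · simp only [g, hfxy] at hxy
        exact (e (f y)).injective hxy
      · exact absurd hxy (hcross _ _ _ _ hfxy).ne
    obtain ⟨u, hu, hXu⟩ := hX (Finset.filter_subset
      (fun p ↦ ∃ x y, H.Adj x y ∧ p = s(g x, g y)) X)
    obtain ⟨G, hG, rfl⟩ := Finset.mem_image.1 hu
    simp only [P, Finset.mem_filter, Finset.mem_univ, true_and] at hG
    refine hG.1.elim ⟨⟨g, hg⟩, ?_⟩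
    intro x y
    change G.Adj (g x) (g y) ↔ H.Adj x y
    by_cases hxy : x = y
    · subst hxy; simp
    by_cases hfxy : f x = f y
    · have hcg : c (g x) = c (g y) := by
        simp only [g, hfxy]
        exact hmono _ _ _
      rw [hG.2 (g x) (g y) (fun h ↦ hxy (hg h)) hcg, hf x y hxy hfxy]
      exact ⟨fun h ↦ ⟨x, h⟩, fun ⟨a, ha⟩ ↦ by rwa [hmono (f x) a x] at ha⟩
    · have hmem : s(g x, g y) ∈ X := hcross' _ _ _ _ hfxy
      have := Finset.ext_iff.1 hXu s(g x, g y)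
      simp only [Finset.mem_inter, Finset.mem_filter, hmem, true_and, mem_edgeFinset,
        mem_edgeSet] at this
      rw [this]
      constructor
      · rintro ⟨x', y', hH, heq⟩
        rcases Sym2.eq_iff.1 heq with ⟨h1, h2⟩ | ⟨h1, h2⟩
        · rw [hg h1, hg h2]; exact hH
        · rw [hg h1, hg h2]; exact hH.symm
      · exact fun hH ↦ ⟨x, y, hH, rfl⟩
  rw [Nat.card_eq_fintype_card, Nat.card_eq_fintype_card, Fintype.card_subtype,
    Fintype.card_subtype]
  change P.card ≤ _
  rw [h𝒜]
  refine 𝒜.card_le_card_shatterer.trans ?_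
  refine Finset.card_le_card_of_injOn (fun X ↦ fromEdgeSet (X : Set (Sym2 V))) ?_ ?_
  · intro X hX
    simpa using hblow X (by simpa using hX)
  · intro X hX Y hY hXY
    simp only [Finset.mem_coe, Finset.mem_shatterer] at hX hY
    ext p
    induction p with
    | _ a b =>
      rw [← hadj X hX, ← hadj Y hY]
      exact iff_of_eq (congrArg (fun G ↦ G.Adj a b) hXY)

theorem exists_card_free_le {h r : ℕ} {H : SimpleGraph (Fin h)} (hr : ¬ GoodR H (r + 1))
    (ε : ℝ) (hε : 0 < ε) : ∃ m₀ : ℕ, ∀ m ≥ m₀,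
      (Nat.card {G : SimpleGraph (Fin m) // IsEmpty (H ↪g G)} : ℝ) ≤
        2 ^ ((((r : ℝ) - 1) / r + ε) * (m : ℝ) ^ 2 / 2) := by
  classical
  obtain ⟨C, hC, hfree⟩ := exists_card_blowupFree_le r h (ε / 2) (by positivity)
  obtain ⟨D, hD, hlog⟩ := exists_le_two_rpow (ε / 16) (by positivity)
  set t := ⌈8 * C / ε⌉₊ + 1 with ht
  obtain ⟨R, hR⟩ := exists_homogeneous_coloring t (by omega)
  set L : ℝ := C * R + ε / 16 * R + D + 1 with hL
  refine ⟨max 1 ⌈16 * (L + R) / ε⌉₊, fun m hm ↦ ?_⟩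
  have hm1 : (1 : ℝ) ≤ m := by exact_mod_cast (le_max_left _ _).trans hm
  have hm2 : 16 * (L + R) / ε ≤ m :=
    (Nat.le_ceil _).trans (by exact_mod_cast (le_max_right _ _).trans hm)
  set k := m / t + R with hk
  set a : ℝ := ((r : ℝ) - 1) / r with ha
  set Φ : ℝ := (a + ε / 2) * (m : ℝ) ^ 2 / 2 + C * m * k with hΦ
  let S : (Fin m → Fin k) × (Fin k → Prop) → Finset (SimpleGraph (Fin m)) := fun x ↦
    Finset.univ.filter fun G ↦ IsEmpty (H ↪g G) ∧ IsHomogeneousColoring x.1 x.2 G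
  have hS : ∀ x ∈ Finset.univ, (S x).card ≤ ⌊(2 : ℝ) ^ Φ⌋₊ := by
    intro x _
    refine Nat.le_floor ?_
    have h1 := card_free_homogeneous_le hr x.1 x.2
    have h2 := hfree (Fin m) k x.1
    rw [Fintype.card_fin] at h2
    refine le_trans ?_ h2
    rw [Nat.card_eq_fintype_card, Fintype.card_subtype] at h1
    exact_mod_cast h1
  have hle : Nat.card {G : SimpleGraph (Fin m) // IsEmpty (H ↪g G)} ≤
      k ^ m * 2 ^ k * ⌊(2 : ℝ) ^ Φ⌋₊ := by
    rw [Nat.card_eq_fintype_card, Fintype.card_subtype]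
    refine (Finset.card_le_card (t := Finset.univ.biUnion S) ?_).trans
      ((Finset.card_biUnion_le_card_mul _ _ _ hS).trans (by simp))
    intro G hG
    have hcol := hR (Fin m) G
    rw [Fintype.card_fin] at hcol
    obtain ⟨c, σ, hcσ⟩ := hcol
    refine Finset.mem_biUnion.2 ⟨(c, σ), Finset.mem_univ _, ?_⟩
    simp only [Finset.mem_filter, Finset.mem_univ, true_and] at hG
    simp only [S, Finset.mem_filter, Finset.mem_univ, true_and]
    exact ⟨hG, hcσ⟩
  have hkm : (k : ℝ) ≤ m / t + R := by
    rw [hk]; push_cast; gcongr; exact Nat.cast_div_le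
  have ht1 : (1 : ℝ) ≤ t := by rw [ht]; push_cast; linarith [Nat.cast_nonneg (α := ℝ) ⌈8 * C / ε⌉₊]
  have ht2 : C ≤ ε / 8 * t := by
    have h1 : 8 * C / ε ≤ t := (Nat.le_ceil _).trans (by rw [ht]; push_cast; linarith)
    rw [div_le_iff₀ hε] at h1
    linarith
  have hkm' : (k : ℝ) ≤ m + R := hkm.trans (by
    gcongr
    exact div_le_self (by positivity) ht1)
  calc (Nat.card {G : SimpleGraph (Fin m) // IsEmpty (H ↪g G)} : ℝ)
      ≤ (k : ℝ) ^ m * 2 ^ k * ⌊(2 : ℝ) ^ Φ⌋₊ := by exact_mod_cast hle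
    _ ≤ (2 ^ (ε / 16 * (k : ℝ) + D)) ^ m * 2 ^ k * (2 : ℝ) ^ Φ := by
        have e1 := hlog k
        have e2 := Nat.floor_le (show (0 : ℝ) ≤ (2 : ℝ) ^ Φ by positivity)
        gcongr
    _ = 2 ^ ((ε / 16 * (k : ℝ) + D) * m + k + Φ) := by
        clear_value Φ
        simp only [← Real.rpow_natCast, ← Real.rpow_mul (show (0 : ℝ) ≤ 2 by norm_num),
          ← Real.rpow_add (show (0 : ℝ) < 2 by norm_num)]
    _ ≤ _ := by
        refine Real.rpow_le_rpow_of_exponent_le (by norm_num) ?_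
        have g1 : C * k ≤ ε / 8 * m + C * R := by
          calc C * k ≤ C * (m / t + R) := by gcongr
            _ = C * (m / t) + C * R := by ring
            _ ≤ (ε / 8 * t) * (m / t) + C * R := by gcongr
            _ = _ := by field_simp
        have g2 : C * k * m ≤ (ε / 8 * m + C * R) * m := by gcongr
        have g3 : (k : ℝ) * m ≤ (m + R) * m := by gcongr
        have g4 : L + R ≤ ε / 16 * m := by
          rw [div_le_iff₀ hε] at hm2
          linarith
        have g5 : (L + R) * m ≤ ε / 16 * m * m := by gcongr
        have g6 : (R : ℝ) ≤ R * m := le_mul_of_one_le_right (by positivity) hm1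
        have g7 : L * m = C * R * m + ε / 16 * R * m + D * m + m := by rw [hL]; ring
        rw [hΦ]
        nlinarith

theorem card_simpleGraph_fin (n : ℕ) : Nat.card (SimpleGraph (Fin n)) = 2 ^ n.choose 2 := by
  classical
  let E : Finset (Sym2 (Fin n)) := (⊤ : SimpleGraph (Fin n)).edgeFinset
  have hE : E.card = n.choose 2 := by
    have := card_edgeFinset_top_eq_card_choose_two (V := Fin n)
    rw [Fintype.card_fin] at this
    convert this
  have e : SimpleGraph (Fin n) ≃ {X : Finset (Sym2 (Fin n)) // X ∈ E.powerset} :=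
    { toFun := fun G ↦ ⟨G.edgeFinset, Finset.mem_powerset.2 (edgeFinset_subset_edgeFinset.2 le_top)⟩
      invFun := fun X ↦ fromEdgeSet (X.1 : Set (Sym2 (Fin n)))
      left_inv := fun G ↦ by simp
      right_inv := fun ⟨X, hX⟩ ↦ by
        have hX' := Finset.mem_powerset.1 hX
        refine Subtype.ext (Finset.ext fun p ↦ ?_)
        simp only [mem_edgeFinset, edgeSet_fromEdgeSet, Set.mem_sdiff, Finset.mem_coe]
        refine ⟨fun h ↦ h.1, fun h ↦ ⟨h, fun hd ↦ ?_⟩⟩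
        exact not_isDiag_of_mem_edgeFinset (hX' h) (by simpa using hd) }
  rw [Nat.card_congr e, Nat.card_eq_fintype_card, Fintype.card_coe, Finset.card_powerset, hE]

theorem le_card_free_of_goodR {h r : ℕ} {H : SimpleGraph (Fin h)} (hr : GoodR H r) (hr0 : 0 < r)
    (n : ℕ) : (2 : ℝ) ^ ((1 - 1 / (r : ℝ)) * (n.choose 2 : ℝ)) ≤
      Nat.card {G : SimpleGraph (Fin n) // IsEmpty (H ↪g G)} := by
  classical
  obtain ⟨s, -, hs⟩ := hr
  let D : Finset ((_ : ℕ) × ℕ) := (Finset.range n).sigma fun j ↦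
    (Finset.range j).filter fun i ↦ ¬ i ≡ j [MOD r]
  have hD : (1 - 1 / (r : ℝ)) * (n.choose 2 : ℝ) ≤ D.card := by
    have h1 : ∀ j : ℕ, (1 - 1 / (r : ℝ)) * j ≤
        ((Finset.range j).filter fun i ↦ ¬ i ≡ j [MOD r]).card := by
      intro j
      have h2 := Nat.count_modEq_card j hr0 j
      rw [if_neg (lt_irrefl _), Nat.count_eq_card_filter_range, add_zero] at h2
      have h3 := Finset.card_filter_add_card_filter_not (s := Finset.range j)
        (fun i ↦ i ≡ j [MOD r])
      rw [h2, Finset.card_range] at h3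
      have h4 : ((j / r : ℕ) : ℝ) ≤ j / r := Nat.cast_div_le
      have h5 : ((j / r : ℕ) : ℝ) + (((Finset.range j).filter fun i ↦ ¬ i ≡ j [MOD r]).card : ℝ)
          = j := by exact_mod_cast h3
      have h6 : (1 - 1 / (r : ℝ)) * j = j - j / r := by ring
      linarith
    rw [Finset.card_sigma]
    push_cast
    have h2 : (n.choose 2 : ℝ) = ∑ j ∈ Finset.range n, (j : ℝ) := by
      rw [← Nat.cast_sum, Finset.sum_range_id, Nat.choose_two_right]
    rw [h2, Finset.mul_sum]
    exact Finset.sum_le_sum fun j _ ↦ h1 j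
  let Γ : Finset ((_ : ℕ) × ℕ) → SimpleGraph (Fin n) := fun X ↦
    { Adj := fun a b ↦ a ≠ b ∧ (((a : ℕ) % r = b % r ∧ (a : ℕ) % r < s) ∨
        ((a : ℕ) % r ≠ b % r ∧ (⟨max a b, min a b⟩ : (_ : ℕ) × ℕ) ∈ X))
      symm := ⟨fun a b ⟨hab, hadj⟩ ↦ ⟨hab.symm, by
        rcases hadj with ⟨h1, h2⟩ | ⟨h1, h2⟩
        · exact .inl ⟨h1.symm, h1 ▸ h2⟩
        · exact .inr ⟨h1.symm, by rwa [max_comm, min_comm]⟩⟩⟩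
      loopless := ⟨fun a ha ↦ ha.1 rfl⟩ }
  have hΓ : ∀ X, IsEmpty (H ↪g Γ X) := by
    intro X
    refine hs n _ ⟨fun v ↦ ⟨v % r, Nat.mod_lt _ hr0⟩, ?_, ?_⟩
    · intro i hi a b ha hb hab
      have ha' := congrArg Fin.val ha
      have hb' := congrArg Fin.val hb
      simp only at ha' hb'
      exact ⟨hab, .inl ⟨by rw [ha', hb'], by rwa [ha']⟩⟩
    · intro i hi a b ha hb hab
      have ha' := congrArg Fin.val ha
      have hb' := congrArg Fin.val hb
      simp only at ha' hb'
      rcases hab.2 with ⟨h1, h2⟩ | ⟨h1, h2⟩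
      · omega
      · exact h1 (by rw [ha', hb'])
  have hinj : Function.Injective (fun X : {X // X ∈ D.powerset} ↦
      (⟨Γ X, hΓ X⟩ : {G : SimpleGraph (Fin n) // IsEmpty (H ↪g G)})) := by
    rintro ⟨X, hX⟩ ⟨Y, hY⟩ hXY
    have hΓXY : Γ X = Γ Y := congrArg Subtype.val hXY
    rw [Finset.mem_powerset] at hX hY
    have key : ∀ p ∈ D, (p ∈ X ↔ p ∈ Y) := by
      rintro ⟨j, i⟩ hp
      simp only [D, Finset.mem_sigma, Finset.mem_range, Finset.mem_filter] at hp
      obtain ⟨hj, hi, hmod⟩ := hp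
      have h1 : (Γ X).Adj ⟨j, hj⟩ ⟨i, hi.trans hj⟩ ↔ (Γ Y).Adj ⟨j, hj⟩ ⟨i, hi.trans hj⟩ := by
        rw [hΓXY]
      have hne : ¬ j % r = i % r := fun h ↦ hmod h.symm
      have hne' : ¬ j = i := by omega
      simpa [Γ, hne, hne', max_eq_left hi.le, min_eq_right hi.le] using h1
    refine Subtype.ext (Finset.ext fun p ↦ ⟨fun hp ↦ ?_, fun hp ↦ ?_⟩)
    · exact (key p (hX hp)).1 hp
    · exact (key p (hY hp)).2 hp
  have hcard := Nat.card_le_card_of_injective _ hinj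
  rw [Nat.card_eq_fintype_card, Fintype.card_coe, Finset.card_powerset] at hcard
  calc (2 : ℝ) ^ ((1 - 1 / (r : ℝ)) * (n.choose 2 : ℝ)) ≤ 2 ^ (D.card : ℝ) :=
        Real.rpow_le_rpow_of_exponent_le (by norm_num) hD
    _ = ((2 ^ D.card : ℕ) : ℝ) := by rw [Real.rpow_natCast]; push_cast; rfl
    _ ≤ _ := by exact_mod_cast hcard

theorem card_perm_extending_mul_le {h n : ℕ} (f g : Fin h ↪ Fin n) :
    Nat.card {π : Equiv.Perm (Fin n) // ∀ x, π (f x) = g x} * n.descFactorial h ≤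
      n.factorial := by
  classical
  let S : (Fin h ↪ Fin n) → Finset (Equiv.Perm (Fin n)) := fun g ↦
    Finset.univ.filter fun π ↦ f.trans π.toEmbedding = g
  have hmono : ∀ g', (S g).card ≤ (S g').card := by
    intro g'
    obtain ⟨σ, hσ⟩ := Equiv.Perm.exists_extending_pair g g' g.injective g'.injective
    refine Finset.card_le_card_of_injOn (fun π ↦ σ * π) ?_ fun π _ π' _ h ↦ mul_left_cancel h
    intro π hπ
    simp only [S, Finset.coe_filter, Finset.mem_univ, true_and, Set.mem_ofPred_eq] at hπ ⊢
    ext x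
    have := congrArg (fun e ↦ e x) hπ
    simp only [Function.Embedding.trans_apply, Equiv.coe_toEmbedding] at this
    simp [this, hσ]
  have hsum : Fintype.card (Equiv.Perm (Fin n)) = ∑ g', (S g').card :=
    Finset.card_eq_sum_card_fiberwise (s := Finset.univ) (t := Finset.univ)
      (f := fun π : Equiv.Perm (Fin n) ↦ f.trans π.toEmbedding) (by simp)
  have hS : Nat.card {π : Equiv.Perm (Fin n) // ∀ x, π (f x) = g x} = (S g).card := by
    rw [Nat.card_eq_fintype_card, Fintype.card_subtype]
    congr 1
    ext π
    simp [S, Function.Embedding.ext_iff]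
  rw [Fintype.card_perm, Fintype.card_fin] at hsum
  rw [hS, hsum, mul_comm]
  have h1 : n.descFactorial h = (Finset.univ : Finset (Fin h ↪ Fin n)).card := by
    rw [Finset.card_univ, Fintype.card_embedding_eq]; simp
  rw [h1, ← smul_eq_mul]
  exact Finset.card_nsmul_le_sum _ _ _ fun g' _ ↦ hmono g'

theorem exists_perm_few_copies {h m n : ℕ} (H : SimpleGraph (Fin h))
    (G : SimpleGraph (Fin n)) {ι : Type} [Fintype ι] (L : ι → Fin m ↪ Fin n) :
    ∃ π : Equiv.Perm (Fin n),
      Nat.card {i // ¬ IsEmpty (H ↪g G.comap fun x ↦ π (L i x))} * n.descFactorial h ≤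
        Fintype.card ι * m ^ h * Nat.card (H ↪g G) := by
  classical
  by_contra hcon
  rw [not_exists] at hcon
  let bad : Equiv.Perm (Fin n) → Finset ι := fun π ↦
    Finset.univ.filter fun i ↦ ¬ IsEmpty (H ↪g G.comap fun x ↦ π (L i x))
  have : Fintype (H ↪g G) := Fintype.ofFinite _
  let S : ι × (Fin h ↪ Fin m) × (H ↪g G) → Finset ((_ : Equiv.Perm (Fin n)) × ι) := fun p ↦
    (Finset.univ.filter fun π : Equiv.Perm (Fin n) ↦
      ∀ x, π ((p.2.1.trans (L p.1)) x) = p.2.2.toEmbedding x).sigma fun _ ↦ {p.1}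
  have hcover : Finset.univ.sigma bad ⊆ Finset.univ.biUnion S := by
    rintro ⟨π, i⟩ hi
    simp only [Finset.mem_sigma, Finset.mem_univ, true_and, bad, Finset.mem_filter,
      not_isEmpty_iff] at hi
    obtain ⟨ψ⟩ := hi
    refine Finset.mem_biUnion.2 ⟨(i, ψ.toEmbedding,
      ⟨⟨fun x ↦ π (L i (ψ x)), fun x y hxy ↦ ψ.injective ((L i).injective (π.injective hxy))⟩,
        ψ.map_rel_iff⟩), Finset.mem_univ _, ?_⟩
    simp only [S, Finset.mem_sigma, Finset.mem_filter, Finset.mem_univ, true_and,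
      Finset.mem_singleton, and_true]
    exact fun x ↦ rfl
  have hS : ∀ p ∈ Finset.univ, (S p).card * n.descFactorial h ≤ n.factorial := by
    intro p _
    refine le_trans (le_of_eq ?_)
      (card_perm_extending_mul_le (p.2.1.trans (L p.1)) p.2.2.toEmbedding)
    rw [Nat.card_eq_fintype_card, Fintype.card_subtype]
    simp [S, Finset.card_sigma]
  have h1 : (∑ π, (bad π).card) * n.descFactorial h ≤
      Fintype.card ι * m ^ h * Nat.card (H ↪g G) * n.factorial := by
    rw [← Finset.card_sigma]
    calc _ ≤ (∑ p, (S p).card) * n.descFactorial h := by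
          gcongr
          exact (Finset.card_le_card hcover).trans Finset.card_biUnion_le
      _ = ∑ p, (S p).card * n.descFactorial h := Finset.sum_mul _ _ _
      _ ≤ ∑ p : ι × (Fin h ↪ Fin m) × (H ↪g G), n.factorial := Finset.sum_le_sum hS
      _ = Fintype.card ι * m.descFactorial h * Nat.card (H ↪g G) * n.factorial := by
          rw [Finset.sum_const, Finset.card_univ]
          simp [Fintype.card_prod, Fintype.card_embedding_eq, mul_assoc]
      _ ≤ _ := by
          gcongr
          exact Nat.descFactorial_le_pow _ _
  have h2 : n.factorial * (Fintype.card ι * m ^ h * Nat.card (H ↪g G)) <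
      (∑ π, (bad π).card) * n.descFactorial h := by
    rw [Finset.sum_mul]
    calc _ = ∑ π : Equiv.Perm (Fin n), Fintype.card ι * m ^ h * Nat.card (H ↪g G) := by
          simp [Finset.card_univ, Fintype.card_perm]
      _ < _ := by
          refine Finset.sum_lt_sum_of_nonempty ⟨1, Finset.mem_univ _⟩ fun π _ ↦ ?_
          have := not_le.1 (hcon π)
          rwa [Nat.card_eq_fintype_card (α := {i // _}), Fintype.card_subtype] at this
  rw [mul_comm] at h2
  exact absurd h2 (not_lt.2 h1)

theorem exists_linear_design (m : ℕ) (hm : 1 ≤ m) (n : ℕ) (hn : m ≤ n) :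
    ∃ (q : ℕ) (ι : Type) (_ : Fintype ι) (L : ι → Fin m ↪ Fin n), m * q ≤ n ∧
      Fintype.card ι = q ^ 2 ∧
      Nat.card {p : Fin n × Fin n // p.1 ≠ p.2 ∧
        ∀ i, ¬ (p.1 ∈ Set.range (L i) ∧ p.2 ∈ Set.range (L i))} ≤
          n * q + 2 * n * (m * (m.factorial + 1)) := by
  classical
  set k := (n / m - 1) / m.factorial with hk
  set q := 1 + m.factorial * k with hq
  have hnm : 1 ≤ n / m := (Nat.one_le_div_iff (by omega)).2 hn
  have hq1 : q ≤ n / m := by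
    have := Nat.mul_div_le (n / m - 1) m.factorial
    rw [← hk] at this
    omega
  have hq2 : n / m < q + m.factorial := by
    have := Nat.lt_mul_div_succ (n / m - 1) (Nat.factorial_pos m)
    rw [← hk, mul_add] at this
    omega
  have hmq : m * q ≤ n := (Nat.mul_le_mul_left m hq1).trans (Nat.mul_div_le n m)
  have hrest : n - m * q ≤ m * (m.factorial + 1) := by
    have h1 := Nat.lt_mul_div_succ n (show 0 < m by omega)
    have h2 : m * (n / m + 1) ≤ m * (q + (m.factorial + 1)) := Nat.mul_le_mul_left _ (by omega)
    rw [mul_add m q] at h2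
    omega
  have : NeZero q := ⟨by omega⟩
  obtain ⟨φ⟩ : Nonempty (Fin m × ZMod q ↪ Fin n) :=
    Function.Embedding.nonempty_of_card_le (by simpa [ZMod.card] using hmq)
  let L : ZMod q × ZMod q → Fin m ↪ Fin n := fun l ↦
    ⟨fun x ↦ φ (x, l.1 * ((x : ℕ) : ZMod q) + l.2), fun x x' h ↦
      (Prod.ext_iff.1 (φ.injective h)).1⟩
  have hunit : ∀ x x' : ℕ, x < x' → x' < m → IsUnit ((x' : ZMod q) - x) := by
    intro x x' hlt hx'
    rw [← Nat.cast_sub hlt.le, ZMod.isUnit_iff_coprime]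
    have hdvd : x' - x ∣ m.factorial := Nat.dvd_factorial (by omega) (by omega)
    have : Nat.Coprime (m.factorial) q := by
      rw [hq, Nat.coprime_add_mul_left_right]
      exact Nat.coprime_one_right _
    exact this.coprime_dvd_left hdvd
  have hcov : ∀ (x x' : Fin m) (y y' : ZMod q), x ≠ x' →
      ∃ i, φ (x, y) ∈ Set.range (L i) ∧ φ (x', y') ∈ Set.range (L i) := by
    intro x x' y y' hne
    have hu : IsUnit (((x' : ℕ) : ZMod q) - (x : ℕ)) := by
      rcases lt_or_gt_of_ne hne with hlt | hlt
      · exact hunit _ _ hlt x'.2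
      · rw [← neg_sub]
        exact (hunit _ _ hlt x.2).neg
    obtain ⟨v, hv⟩ := hu
    refine ⟨((y' - y) * ↑v⁻¹, y - (y' - y) * ↑v⁻¹ * ((x : ℕ) : ZMod q)), ⟨x, ?_⟩, ⟨x', ?_⟩⟩
    · change φ _ = φ _
      congr 2
      simp
    · change φ _ = φ _
      congr 2
      have h1 : (↑v⁻¹ : ZMod q) * v = 1 := Units.inv_mul v
      rw [hv] at h1
      linear_combination (y' - y) * h1
  refine ⟨q, ZMod q × ZMod q, inferInstance, L, hmq, by simp [ZMod.card, sq], ?_⟩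
  let R : Finset (Fin n) := Finset.univ.map φ
  have hR : Rᶜ.card = n - m * q := by
    simp [R, Finset.card_compl, ZMod.card]
  let I : Finset (Fin n × Fin n) := Finset.univ.image fun z : Fin m × ZMod q × ZMod q ↦
    (φ (z.1, z.2.1), φ (z.1, z.2.2))
  rw [Nat.card_eq_fintype_card, Fintype.card_subtype]
  have hsub : (Finset.univ.filter fun p : Fin n × Fin n ↦ p.1 ≠ p.2 ∧
      ∀ i, ¬ (p.1 ∈ Set.range (L i) ∧ p.2 ∈ Set.range (L i))) ⊆
      I ∪ (Rᶜ ×ˢ Finset.univ ∪ Finset.univ ×ˢ Rᶜ) := by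
    rintro ⟨u, v⟩ hp
    simp only [Finset.mem_filter, Finset.mem_univ, true_and] at hp
    by_cases hu : u ∈ R
    · by_cases hv : v ∈ R
      · simp only [R, Finset.mem_map, Finset.mem_univ, true_and] at hu hv
        obtain ⟨⟨x, y⟩, rfl⟩ := hu
        obtain ⟨⟨x', y'⟩, rfl⟩ := hv
        by_cases hx : x = x'
        · subst hx
          exact Finset.mem_union_left _ (Finset.mem_image.2 ⟨(x, y, y'), Finset.mem_univ _, rfl⟩)
        · obtain ⟨i, hi⟩ := hcov x x' y y' hx
          exact absurd hi (hp.2 i)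
      · exact Finset.mem_union_right _ (Finset.mem_union_right _ (by simp [hv]))
    · exact Finset.mem_union_right _ (Finset.mem_union_left _ (by simp [hu]))
  refine (Finset.card_le_card hsub).trans ((Finset.card_union_le _ _).trans ?_)
  have h1 : I.card ≤ n * q := by
    refine Finset.card_image_le.trans ?_
    simp only [Finset.card_univ, Fintype.card_prod, Fintype.card_fin, ZMod.card]
    rw [← mul_assoc]
    gcongr
  have h2 := Finset.card_union_le (Rᶜ ×ˢ (Finset.univ : Finset (Fin n))) (Finset.univ ×ˢ Rᶜ)
  rw [Finset.card_product, Finset.card_product, hR, Finset.card_univ, Fintype.card_fin] at h2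
  have h3 : n * (n - m * q) ≤ n * (m * (m.factorial + 1)) := Nat.mul_le_mul_left _ hrest
  rw [mul_comm (n - m * q) n] at h2
  rw [mul_assoc 2 n]
  omega

theorem card_few_copies_le {h m n : ℕ} (H : SimpleGraph (Fin h)) {ι : Type} [Fintype ι]
    (L : ι → Fin m ↪ Fin n) (K β : ℕ) (hβ : 1 ≤ β)
    (hfree : Nat.card {G : SimpleGraph (Fin m) // IsEmpty (H ↪g G)} ≤ β) :
    Nat.card {G : SimpleGraph (Fin n) // ∃ π : Equiv.Perm (Fin n),
      Nat.card {i // ¬ IsEmpty (H ↪g G.comap fun x ↦ π (L i x))} ≤ K} ≤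
    n.factorial * (2 ^ Fintype.card ι * (2 ^ m ^ 2) ^ K * β ^ Fintype.card ι *
      2 ^ Nat.card {p : Fin n × Fin n // p.1 ≠ p.2 ∧
        ∀ i, ¬ (p.1 ∈ Set.range (L i) ∧ p.2 ∈ Set.range (L i))}) := by
  classical
  let S : Equiv.Perm (Fin n) → Finset (SimpleGraph (Fin n)) := fun π ↦ Finset.univ.filter fun G ↦
    Nat.card {i // ¬ IsEmpty (H ↪g G.comap fun x ↦ π (L i x))} ≤ K
  let U : Type := {p : Fin n × Fin n // p.1 ≠ p.2 ∧
        ∀ i, ¬ (p.1 ∈ Set.range (L i) ∧ p.2 ∈ Set.range (L i))}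
  let B : Finset (SimpleGraph (Fin m)) := Finset.univ.filter fun G ↦ IsEmpty (H ↪g G)
  have hB : B.card ≤ β := by
    rwa [Nat.card_eq_fintype_card, Fintype.card_subtype] at hfree
  have hS : ∀ π ∈ Finset.univ, (S π).card ≤
      2 ^ Fintype.card ι * (2 ^ m ^ 2) ^ K * β ^ Fintype.card ι * 2 ^ Nat.card U := by
    intro π _
    have hbad : ∀ G ∈ S π,
        Nat.card {i // (fun j ↦ G.comap fun x ↦ π (L j x)) i ∉ B} ≤ K := by
      intro G hG
      simpa [S, B] using hG
    let Φ : {G // G ∈ S π} → {τ : ι → SimpleGraph (Fin m) // Nat.card {i // τ i ∉ B} ≤ K} ×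
        Set U := fun G ↦
      (⟨fun i ↦ G.1.comap fun x ↦ π (L i x), hbad _ G.2⟩, {p | G.1.Adj (π p.1.1) (π p.1.2)})
    have hΦ : Function.Injective Φ := by
      rintro ⟨G, hG⟩ ⟨G', hG'⟩ heq
      simp only [Φ, Prod.mk.injEq, Subtype.mk.injEq] at heq
      obtain ⟨h1, h2⟩ := heq
      rw [Subtype.mk.injEq]
      ext u v
      obtain ⟨u, rfl⟩ := π.surjective u
      obtain ⟨v, rfl⟩ := π.surjective v
      by_cases huv : u = v
      · subst huv; simp
      by_cases hU : ∀ i, ¬ (u ∈ Set.range (L i) ∧ v ∈ Set.range (L i))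
      · exact Set.ext_iff.1 h2 ⟨(u, v), huv, hU⟩
      · push Not at hU
        obtain ⟨i, ⟨x, rfl⟩, ⟨y, rfl⟩⟩ := hU
        have := congrArg (fun G ↦ G.Adj x y) (congrFun h1 i)
        simpa using this
    have h1 := Nat.card_le_card_of_injective Φ hΦ
    rw [Nat.card_prod, Nat.card_eq_fintype_card, Fintype.card_coe] at h1
    refine h1.trans (Nat.mul_le_mul ?_ ?_)
    · refine card_functions_few_exceptions B K (2 ^ m ^ 2) β hB hβ ?_ Nat.one_le_two_pow
      simpa [Nat.card_eq_fintype_card] using card_simpleGraph_le (Fin m)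
    · rw [Nat.card_eq_fintype_card, Fintype.card_set, Nat.card_eq_fintype_card]
  rw [Nat.card_eq_fintype_card, Fintype.card_subtype]
  refine (Finset.card_le_card (t := Finset.univ.biUnion S) ?_).trans
    ((Finset.card_biUnion_le_card_mul _ _ _ hS).trans ?_)
  · intro G hG
    simp only [Finset.mem_filter, Finset.mem_univ, true_and] at hG
    obtain ⟨π, hπ⟩ := hG
    refine Finset.mem_biUnion.2 ⟨π, Finset.mem_univ π, ?_⟩
    simp only [S, Finset.mem_filter, Finset.mem_univ, true_and]
    exact hπ
  · rw [Finset.card_univ, Fintype.card_perm, Fintype.card_fin]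

theorem card_embedding_le_pow {h n : ℕ} (H : SimpleGraph (Fin h)) (G : SimpleGraph (Fin n)) :
    Nat.card (H ↪g G) ≤ n ^ h := by
  have := Nat.card_le_card_of_injective (fun φ : H ↪g G ↦ (φ : Fin h → Fin n))
    DFunLike.coe_injective
  simpa using this

theorem exists_card_few_copies_le {h r : ℕ} {H : SimpleGraph (Fin h)} (hr : ¬ GoodR H (r + 1))
    (hr0 : 1 ≤ r) (ε : ℝ) (hε : 0 < ε) :
    ∃ ρ : ℝ, 0 < ρ ∧ ∃ E : ℝ, ∃ N : ℕ, ∀ n ≥ N,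
      (Nat.card {G : SimpleGraph (Fin n) // (Nat.card (H ↪g G) : ℝ) ≤ ρ * (n : ℝ) ^ h} : ℝ) ≤
        2 ^ ((1 - 1 / (r : ℝ) + 2 * ε) * (n : ℝ) ^ 2 / 2 + E * n) := by
  obtain ⟨m₀, hm₀⟩ := exists_card_free_le hr ε hε
  obtain ⟨m₁, hm₁⟩ := exists_nat_gt (8 / ε)
  obtain ⟨D, -, hD⟩ := exists_le_two_rpow (ε / 8) (by positivity)
  obtain ⟨m, hmm₀, hmm₁, hm1⟩ : ∃ m, m₀ ≤ m ∧ m₁ ≤ m ∧ 1 ≤ m :=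
    ⟨max m₀ (max m₁ 1), by simp, by simp, by simp⟩
  have hm1R : (1 : ℝ) ≤ m := by exact_mod_cast hm1
  have hmε : 8 ≤ ε * m := by
    have h1 : (m₁ : ℝ) ≤ m := by exact_mod_cast hmm₁
    have h2 : 8 / ε ≤ m := hm₁.le.trans h1
    rw [div_le_iff₀ hε] at h2
    linarith
  have hr1R : (1 : ℝ) ≤ r := by exact_mod_cast hr0
  have ha : 0 ≤ 1 - 1 / (r : ℝ) := by
    rw [sub_nonneg, div_le_one (by linarith)]
    exact hr1R
  have hfree := hm₀ m hmm₀
  rw [show ((r : ℝ) - 1) / r = 1 - 1 / (r : ℝ) by field_simp] at hfree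
  set a : ℝ := 1 - 1 / (r : ℝ)
  set B : ℝ := (a + ε) * (m : ℝ) ^ 2 / 2 with hB
  have hB0 : 0 ≤ B := by positivity
  have hβ : 1 ≤ ⌊(2 : ℝ) ^ B⌋₊ := Nat.le_floor (by
    rw [Nat.cast_one]
    exact Real.one_le_rpow (by norm_num) hB0)
  set δ : ℝ := ε / 8 with hδ
  have hδ0 : 0 < δ := by positivity
  set M : ℝ := m * (m.factorial + 1) with hM
  refine ⟨δ / (2 * m) ^ h, by positivity, D + 2 * M, max m (2 * h), fun n hn ↦ ?_⟩
  have hmn : m ≤ n := (le_max_left _ _).trans hn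
  have hhn : 2 * h ≤ n := (le_max_right _ _).trans hn
  have hn0 : (0 : ℝ) < n := by exact_mod_cast (hm1.trans hmn)
  obtain ⟨q, ι, _, L, hmq, hι, hunc⟩ := exists_linear_design m hm1 n hmn
  have hdesc : ((n : ℝ) / 2) ^ h ≤ n.descFactorial h := by
    have h1 : (((n + 1 - h : ℕ) : ℝ)) ^ h ≤ n.descFactorial h := by
      exact_mod_cast Nat.pow_sub_le_descFactorial n h
    refine le_trans (pow_le_pow_left₀ (by positivity) ?_ h) h1
    rw [Nat.cast_sub (by omega)]
    have : (2 * h : ℝ) ≤ n := by exact_mod_cast hhn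
    push_cast
    linarith
  have hfew : ∀ G : SimpleGraph (Fin n),
      (Nat.card (H ↪g G) : ℝ) ≤ δ / (2 * m) ^ h * (n : ℝ) ^ h → ∃ π : Equiv.Perm (Fin n),
        Nat.card {i // ¬ IsEmpty (H ↪g G.comap fun x ↦ π (L i x))} ≤ ⌊δ * (q : ℝ) ^ 2⌋₊ := by
    intro G hG
    obtain ⟨π, hπ⟩ := exists_perm_few_copies H G L
    refine ⟨π, Nat.le_floor ?_⟩
    rw [hι] at hπ
    have hπ' : (Nat.card {i // ¬ IsEmpty (H ↪g G.comap fun x ↦ π (L i x))} : ℝ) *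
        n.descFactorial h ≤ (q : ℝ) ^ 2 * m ^ h * Nat.card (H ↪g G) := by exact_mod_cast hπ
    have hpos : (0 : ℝ) < ((n : ℝ) / 2) ^ h := by positivity
    refine le_of_mul_le_mul_right ?_ hpos
    calc _ ≤ (q : ℝ) ^ 2 * m ^ h * Nat.card (H ↪g G) :=
          (mul_le_mul_of_nonneg_left hdesc (Nat.cast_nonneg _)).trans hπ'
      _ ≤ (q : ℝ) ^ 2 * m ^ h * (δ / (2 * m) ^ h * (n : ℝ) ^ h) :=
          mul_le_mul_of_nonneg_left hG (by positivity)
      _ = δ * (q : ℝ) ^ 2 * ((n : ℝ) / 2) ^ h := by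
          rw [mul_pow, div_pow]
          field_simp
  have hcard : Nat.card {G : SimpleGraph (Fin n) //
      (Nat.card (H ↪g G) : ℝ) ≤ δ / (2 * m) ^ h * (n : ℝ) ^ h} ≤ _ :=
    (Nat.card_le_card_of_injective _ (Subtype.map_injective (f := id) hfew
      Function.injective_id)).trans
      (card_few_copies_le H L ⌊δ * (q : ℝ) ^ 2⌋₊ ⌊(2 : ℝ) ^ B⌋₊ hβ (Nat.le_floor hfree))
  rw [hι] at hcard
  have hfact : (n.factorial : ℝ) ≤ 2 ^ ((δ * n + D) * n) := by
    calc (n.factorial : ℝ) ≤ (n : ℝ) ^ n := by exact_mod_cast Nat.factorial_le_pow n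
      _ ≤ (2 ^ (δ * n + D)) ^ n := pow_le_pow_left₀ hn0.le (hD n) n
      _ = _ := by rw [Real.rpow_mul_natCast (by norm_num)]
  have hK : (((2 : ℝ) ^ m ^ 2) ^ ⌊δ * (q : ℝ) ^ 2⌋₊) ≤ 2 ^ ((m : ℝ) ^ 2 * (δ * (q : ℝ) ^ 2)) := by
    rw [← pow_mul, ← Real.rpow_natCast]
    refine Real.rpow_le_rpow_of_exponent_le (by norm_num) ?_
    push_cast
    gcongr
    exact Nat.floor_le (by positivity)
  have hβ' : ((⌊(2 : ℝ) ^ B⌋₊ : ℝ)) ^ q ^ 2 ≤ 2 ^ (B * (q : ℝ) ^ 2) := by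
    calc ((⌊(2 : ℝ) ^ B⌋₊ : ℝ)) ^ q ^ 2 ≤ ((2 : ℝ) ^ B) ^ q ^ 2 :=
          pow_le_pow_left₀ (Nat.cast_nonneg _) (Nat.floor_le (by positivity)) _
      _ = _ := by rw [← Real.rpow_mul_natCast (by norm_num)]; push_cast; rfl
  have hU : (2 : ℝ) ^ Nat.card {p : Fin n × Fin n // p.1 ≠ p.2 ∧
      ∀ i, ¬ (p.1 ∈ Set.range (L i) ∧ p.2 ∈ Set.range (L i))} ≤
      2 ^ ((n : ℝ) * q + 2 * n * M) := by
    rw [← Real.rpow_natCast]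
    refine Real.rpow_le_rpow_of_exponent_le (by norm_num) ?_
    rw [hM]
    exact_mod_cast hunc
  have hq : (2 : ℝ) ^ q ^ 2 = 2 ^ ((q : ℝ) ^ 2) := by
    rw [← Real.rpow_natCast]; push_cast; rfl
  have hmqR : (m : ℝ) * q ≤ n := by exact_mod_cast hmq
  have hmq2 : (m : ℝ) ^ 2 * (q : ℝ) ^ 2 ≤ (n : ℝ) ^ 2 := by
    rw [← mul_pow]
    exact pow_le_pow_left₀ (by positivity) hmqR 2
  have hq0 : (0 : ℝ) ≤ q := Nat.cast_nonneg q
  have h8q : 8 * (q : ℝ) ≤ ε * n := by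
    calc 8 * (q : ℝ) ≤ ε * m * q := mul_le_mul_of_nonneg_right hmε hq0
      _ = ε * (m * q) := by ring
      _ ≤ ε * n := mul_le_mul_of_nonneg_left hmqR hε.le
  have hqn : (q : ℝ) ≤ n := by
    refine le_trans ?_ hmqR
    exact le_mul_of_one_le_left hq0 hm1R
  have h8nq : 8 * ((n : ℝ) * q) ≤ ε * (n : ℝ) ^ 2 := by nlinarith
  have h8qq : 8 * (q : ℝ) ^ 2 ≤ ε * (n : ℝ) ^ 2 := by nlinarith
  have hBq : B * (q : ℝ) ^ 2 ≤ (a + ε) * (n : ℝ) ^ 2 / 2 := by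
    rw [hB]
    have := mul_le_mul_of_nonneg_left hmq2 (add_nonneg ha hε.le)
    linarith
  have hδq : (m : ℝ) ^ 2 * (δ * (q : ℝ) ^ 2) ≤ δ * (n : ℝ) ^ 2 := by
    have := mul_le_mul_of_nonneg_left hmq2 hδ0.le
    linarith
  calc _ ≤ (n.factorial : ℝ) * (2 ^ q ^ 2 * (2 ^ m ^ 2) ^ ⌊δ * (q : ℝ) ^ 2⌋₊ *
        (⌊(2 : ℝ) ^ B⌋₊ : ℝ) ^ q ^ 2 * 2 ^ Nat.card {p : Fin n × Fin n // p.1 ≠ p.2 ∧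
          ∀ i, ¬ (p.1 ∈ Set.range (L i) ∧ p.2 ∈ Set.range (L i))}) := by exact_mod_cast hcard
    _ ≤ 2 ^ ((δ * n + D) * n) * (2 ^ ((q : ℝ) ^ 2) * 2 ^ ((m : ℝ) ^ 2 * (δ * (q : ℝ) ^ 2)) *
        2 ^ (B * (q : ℝ) ^ 2) * 2 ^ ((n : ℝ) * q + 2 * n * M)) := by
        rw [hq]
        gcongr
    _ = 2 ^ ((δ * n + D) * n + ((q : ℝ) ^ 2 + (m : ℝ) ^ 2 * (δ * (q : ℝ) ^ 2) +
        B * (q : ℝ) ^ 2 + ((n : ℝ) * q + 2 * n * M))) := by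
        simp only [Real.rpow_add (show (0 : ℝ) < 2 by norm_num)]
    _ ≤ _ := by
        refine Real.rpow_le_rpow_of_exponent_le (by norm_num) ?_
        rw [hδ] at hδq ⊢
        linarith

theorem stmt10 (h r : ℕ) (H : SimpleGraph (Fin h)) (hr : IsColoringNumber H r)
    (ξ : ℝ) (hξ : 0 < ξ) :
    ∃ ρ : ℝ, 0 < ρ ∧ ∃ N : ℕ, ∀ n ≥ N,
      (1 - 1/(r:ℝ)) * (n.choose 2 : ℝ) ≤
        Real.logb 2 (Nat.card {G : SimpleGraph (Fin n) //
          (Nat.card (H ↪g G) : ℝ) ≤ ρ * (n:ℝ)^h}) ∧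
      Real.logb 2 (Nat.card {G : SimpleGraph (Fin n) //
          (Nat.card (H ↪g G) : ℝ) ≤ ρ * (n:ℝ)^h}) ≤
        (1 - 1/(r:ℝ) + ξ) * (n.choose 2 : ℝ) := by
  rcases Nat.eq_zero_or_pos r with rfl | hr0
  · refine ⟨1, one_pos, 0, fun n _ ↦ ?_⟩
    have hall : ∀ G : SimpleGraph (Fin n), (Nat.card (H ↪g G) : ℝ) ≤ 1 * (n : ℝ) ^ h := by
      intro G
      rw [one_mul]
      exact_mod_cast card_embedding_le_pow H G
    rw [Nat.card_congr (Equiv.subtypeUnivEquiv hall), card_simpleGraph_fin]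
    have hlog : Real.logb 2 ((2 ^ n.choose 2 : ℕ) : ℝ) = n.choose 2 := by
      rw [Nat.cast_pow, Nat.cast_ofNat, Real.logb_pow, Real.logb_self_eq_one (by norm_num), mul_one]
    rw [hlog]
    have : 0 ≤ ξ * (n.choose 2 : ℝ) := by positivity
    constructor
    · simp
    · simp only [Nat.cast_zero, div_zero, sub_zero]
      linarith
  · have hbad : ¬ GoodR H (r + 1) := fun hg ↦ by
      have := hr.2 _ hg
      omega
    obtain ⟨ρ, hρ, E, N, hN⟩ := exists_card_few_copies_le hbad hr0 (ξ / 4) (by positivity)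
    obtain ⟨N', hN'⟩ := exists_nat_ge ((2 * E + (1 - 1 / (r : ℝ)) + ξ) / (ξ / 2))
    refine ⟨ρ, hρ, max N N', fun n hn ↦ ?_⟩
    have hle : (2 : ℝ) ^ ((1 - 1 / (r : ℝ)) * (n.choose 2 : ℝ)) ≤
        Nat.card {G : SimpleGraph (Fin n) // (Nat.card (H ↪g G) : ℝ) ≤ ρ * (n : ℝ) ^ h} := by
      refine (le_card_free_of_goodR hr.1 hr0 n).trans (Nat.cast_le.2 ?_)
      refine Nat.card_le_card_of_injective _ (Subtype.map_injective (f := id)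
        (fun G (hG : IsEmpty (H ↪g G)) ↦ ?_) Function.injective_id)
      rw [id, Nat.card_of_isEmpty, Nat.cast_zero]
      positivity
    have hpos := lt_of_lt_of_le (by positivity) hle
    refine ⟨(Real.le_logb_iff_rpow_le (by norm_num) hpos).2 hle,
      (Real.logb_le_iff_le_rpow (by norm_num) hpos).2 ((hN n ((le_max_left _ _).trans hn)).trans
        (Real.rpow_le_rpow_of_exponent_le (by norm_num) ?_))⟩
    have hnN' : (N' : ℝ) ≤ n := by exact_mod_cast (le_max_right _ _).trans hn
    have h1 := hN'.trans hnN'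
    rw [div_le_iff₀ (by positivity)] at h1
    have h2 := mul_le_mul_of_nonneg_left h1 (Nat.cast_nonneg n)
    rw [Nat.cast_choose_two]
    linarith
end

section
/- For every r ≥ 2 and ε > 0, there exists δ > 0 such that for all sufficiently large n, log₂ |P_n(K_{r+1}(⌊δ(log n)^{1/r}⌋, ..., ⌊δ(log n)^{1/r}⌋))| ≤ (1 - 1/r + ε)·C(n,2), where the forbidden graph is the complete (r+1)-partite graph with all r+1 parts of size ⌊δ(log n)^{1/r}⌋. -/
open SimpleGraph

/-- `H` is contained in `G` as a (not necessarily induced) subgraph. -/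
def Contains {α β : Type*} (H : SimpleGraph α) (G : SimpleGraph β) : Prop :=
  ∃ f : H →g G, Function.Injective f

open scoped Classical in
/-- The tuples `x` with `x i ∈ W i` whose entries are pairwise adjacent in `G`. -/
noncomputable def cliqueTuples {V : Type*} [Fintype V] (G : SimpleGraph V) {k : ℕ}
    (W : Fin k → Finset V) : Finset (Fin k → V) :=
  {x | (∀ i, x i ∈ W i) ∧ Pairwise fun i j ↦ G.Adj (x i) (x j)}

open scoped Classical in
theorem mem_cliqueTuples {V : Type*} [Fintype V] {G : SimpleGraph V} {k : ℕ}
    {W : Fin k → Finset V} {x : Fin k → V} :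
    x ∈ cliqueTuples G W ↔ (∀ i, x i ∈ W i) ∧ Pairwise fun i j ↦ G.Adj (x i) (x j) := by
  simp [cliqueTuples]

open scoped Classical in
theorem card_interedges_eq_sum {V : Type*} (G : SimpleGraph V) (s t : Finset V) :
    (G.interedges s t).card = ∑ v ∈ s, (t.filter (G.Adj v)).card := by
  rw [SimpleGraph.interedges, Rel.interedges, Finset.card_filter, Finset.sum_product]
  simp only [Finset.card_filter]

open scoped Classical in
theorem sum_card_cliqueTuples_le {V : Type*} [Fintype V] (G : SimpleGraph V) {k : ℕ}
    (W : Fin (k + 1) → Finset V) {S : Finset V} (hS : S ⊆ W 0) :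
    ∑ v ∈ S, (cliqueTuples G fun i : Fin k ↦ (W i.succ).filter (G.Adj v)).card ≤
      (cliqueTuples G W).card := by
  rw [← Finset.card_sigma]
  refine Finset.card_le_card_of_injOn (fun p ↦ (Fin.cons p.1 p.2 : Fin (k + 1) → V)) ?_ ?_
  · rintro ⟨v, y⟩ h
    simp only [Finset.mem_coe, Finset.mem_sigma, mem_cliqueTuples, Finset.mem_filter] at h ⊢
    obtain ⟨hv, h1, h2⟩ := h
    refine ⟨fun i ↦ ?_, fun i j hij ↦ ?_⟩
    · refine Fin.cases (hS hv) (fun i ↦ ?_) i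
      simpa using (h1 i).1
    · induction i using Fin.cases with
      | zero =>
        induction j using Fin.cases with
        | zero => exact absurd rfl hij
        | succ j => simpa using (h1 j).2
      | succ i =>
        induction j using Fin.cases with
        | zero => simpa using (h1 i).2.symm
        | succ j => simpa using h2 (fun h ↦ hij (by rw [h]))
  · rintro ⟨v, y⟩ - ⟨v', y'⟩ - h
    obtain ⟨rfl, rfl⟩ := Fin.cons_inj.1 h
    rfl

open scoped Classical in
/-- A counting lemma: if all pairs among `k` vertex sets are dense on large subsets, then
a positive proportion of transversals are cliques. -/
theorem exists_le_card_cliqueTuples (k : ℕ) : ∀ d : ℝ, 0 < d → d ≤ 1 →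
    ∃ η > 0, ∃ c > 0, ∀ {V : Type} [Fintype V] (G : SimpleGraph V) (M : ℝ), 0 < M →
      ∀ W : Fin k → Finset V, (∀ i, M ≤ (W i).card) →
      (∀ i j, i ≠ j → ∀ s ⊆ W i, ∀ t ⊆ W j, η * M ≤ s.card → η * M ≤ t.card →
        d * s.card * t.card ≤ (G.interedges s t).card) →
      c * M ^ k ≤ (cliqueTuples G W).card := by
  induction k with
  | zero =>
    intro d _ _
    refine ⟨1, one_pos, 1, one_pos, fun {V} _ G M _ W _ _ ↦ ?_⟩
    have : 0 < (cliqueTuples G W).card :=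
      Finset.card_pos.2 ⟨Fin.elim0, mem_cliqueTuples.2 ⟨fun i ↦ i.elim0, fun i ↦ i.elim0⟩⟩
    simpa using Nat.one_le_iff_ne_zero.2 this.ne'
  | succ k ih =>
    intro d hd hd1
    obtain ⟨η', hη', c', hc', h⟩ := ih d hd hd1
    set η := min (d * η') (1 / (2 * (k + 1))) with hη
    have hη0 : 0 < η := by positivity
    have hηk : k * η ≤ 1 / 2 := by
      have : η ≤ 1 / (2 * (k + 1)) := min_le_right _ _
      calc k * η ≤ k * (1 / (2 * (k + 1))) := by gcongr
        _ ≤ 1 / 2 := by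
          rw [mul_one_div, div_le_div_iff₀ (by positivity) (by norm_num)]; linarith
    have hη1 : η ≤ 1 := by
      refine (min_le_right _ _).trans ?_
      rw [div_le_one (by positivity)]
      have : (0 : ℝ) ≤ k := Nat.cast_nonneg k
      linarith
    refine ⟨η, hη0, c' * d ^ k / 2, by positivity, fun {V} _ G M hM W hW hreg ↦ ?_⟩
    let B : Fin k → Finset V := fun i ↦
      {v ∈ W 0 | (((W i.succ).filter (G.Adj v)).card : ℝ) < d * (W i.succ).card}
    have hB : ∀ i, ((B i).card : ℝ) ≤ η * M := by
      intro i
      by_contra! hlt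
      have hsub : B i ⊆ W 0 := Finset.filter_subset _ _
      have h1 := hreg 0 i.succ (Fin.succ_ne_zero i).symm (B i) hsub (W i.succ) subset_rfl hlt.le
        (le_trans (by nlinarith) (hW _))
      rw [card_interedges_eq_sum, Nat.cast_sum] at h1
      have hne : (B i).Nonempty := by
        rw [← Finset.card_pos]
        have : 0 < η * M := by positivity
        exact_mod_cast this.trans hlt
      have h2 : ∑ v ∈ B i, (((W i.succ).filter (G.Adj v)).card : ℝ) <
          ∑ v ∈ B i, d * (W i.succ).card :=
        Finset.sum_lt_sum_of_nonempty hne fun v hv ↦ (Finset.mem_filter.1 hv).2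
      rw [Finset.sum_const, nsmul_eq_mul] at h2
      nlinarith
    let S := W 0 \ Finset.univ.biUnion B
    have hS : M / 2 ≤ S.card := by
      have h1 : ((Finset.univ.biUnion B).card : ℝ) ≤ k * (η * M) := by
        calc ((Finset.univ.biUnion B).card : ℝ) ≤ ∑ i, ((B i).card : ℝ) := by
              exact_mod_cast Finset.card_biUnion_le
          _ ≤ ∑ _i : Fin k, η * M := Finset.sum_le_sum fun i _ ↦ hB i
          _ = k * (η * M) := by simp
      have h2 : ((W 0).card : ℝ) ≤ S.card + (Finset.univ.biUnion B).card := by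
        exact_mod_cast Nat.sub_le_iff_le_add.1 (Finset.le_card_sdiff (Finset.univ.biUnion B) (W 0))
      have h3 := hW 0
      nlinarith
    have key : ∀ v ∈ S, c' * (d * M) ^ k ≤
        (cliqueTuples G fun i : Fin k ↦ (W i.succ).filter (G.Adj v)).card := by
      intro v hv
      obtain ⟨hv0, hvB⟩ := Finset.mem_sdiff.1 hv
      refine h G (d * M) (by positivity) _ (fun i ↦ ?_) ?_
      · have : v ∉ B i := fun hi ↦ hvB (Finset.mem_biUnion.2 ⟨i, Finset.mem_univ _, hi⟩)
        simp only [B, Finset.mem_filter, hv0, true_and, not_lt] at this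
        refine le_trans ?_ this
        gcongr
        exact hW _
      · intro i j hij s hs t ht hsM htM
        have : η * M ≤ η' * (d * M) := by
          have : η ≤ d * η' := min_le_left _ _
          nlinarith
        exact hreg _ _ (by simpa using hij) s (hs.trans (Finset.filter_subset _ _)) t
          (ht.trans (Finset.filter_subset _ _)) (this.trans hsM) (this.trans htM)
    calc c' * d ^ k / 2 * M ^ (k + 1) = M / 2 * (c' * (d * M) ^ k) := by ring
      _ ≤ S.card * (c' * (d * M) ^ k) := by gcongr
      _ = ∑ v ∈ S, c' * (d * M) ^ k := by simp
      _ ≤ ∑ v ∈ S, ((cliqueTuples G fun i : Fin k ↦ (W i.succ).filter (G.Adj v)).card : ℝ) :=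
        Finset.sum_le_sum key
      _ ≤ _ := by exact_mod_cast sum_card_cliqueTuples_le G W Finset.sdiff_subset

theorem pow_sub_descFactorial_le (n m : ℕ) (hn : 0 < n) (hmn : m ≤ n) :
    (n : ℝ) ^ m * (1 - m ^ 2 / n) ≤ n.descFactorial m := by
  have hn' : (0 : ℝ) < n := by exact_mod_cast hn
  have hmn' : (m : ℝ) ≤ n := by exact_mod_cast hmn
  have h1 : (1 : ℝ) - m ^ 2 / n ≤ (1 - m / n) ^ m := by
    have := one_add_mul_le_pow (a := -(m / n : ℝ))
      (by have := (div_le_one hn').2 hmn'; linarith) m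
    calc (1 : ℝ) - m ^ 2 / n = 1 + m * -(m / n) := by ring
      _ ≤ _ := this
      _ = _ := by ring
  calc (n : ℝ) ^ m * (1 - m ^ 2 / n) ≤ n ^ m * (1 - m / n) ^ m := by gcongr
    _ = (n - m) ^ m := by rw [← mul_pow]; congr 1; field_simp
    _ ≤ ((n + 1 - m : ℕ) : ℝ) ^ m := by
        gcongr
        rw [Nat.cast_sub (by omega)]; push_cast; linarith
    _ ≤ _ := by exact_mod_cast Nat.pow_sub_le_descFactorial n m

open scoped Classical in
theorem card_not_injective_le {V : Type*} [Fintype V] (m : ℕ) (hV : 0 < Fintype.card V)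
    (hmn : m ≤ Fintype.card V) :
    (({A : Fin m → V | ¬ Function.Injective A} : Finset (Fin m → V)).card : ℝ) ≤
      (Fintype.card V : ℝ) ^ m * (m ^ 2 / Fintype.card V) := by
  have h1 : ({A : Fin m → V | Function.Injective A} : Finset (Fin m → V)).card =
      (Fintype.card V).descFactorial m := by
    rw [← Fintype.card_subtype, Fintype.card_congr (Equiv.subtypeInjectiveEquivEmbedding _ _),
      Fintype.card_embedding_eq, Fintype.card_fin]
  have h2 := Finset.card_filter_add_card_filter_not (s := (Finset.univ : Finset (Fin m → V)))
    Function.Injective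
  rw [h1, Finset.card_univ, Fintype.card_fun, Fintype.card_fin] at h2
  have h3 := pow_sub_descFactorial_le _ m hV hmn
  have h4 : ((Fintype.card V).descFactorial m : ℝ) +
    (({A : Fin m → V | ¬ Function.Injective A} : Finset (Fin m → V)).card : ℝ) =
    (Fintype.card V : ℝ) ^ m := by exact_mod_cast h2
  linarith

open scoped Classical in
/-- A dense set of tuples has many tails that extend by every element of a common `m`-set. -/
theorem exists_injective_le_card_tails {V : Type*} [Fintype V] {k m : ℕ} (hm : 1 ≤ m) {c : ℝ}
    (hc : 0 < c) (hc1 : c ≤ 1 / 2) (H : Finset (Fin (k + 1) → V))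
    (hH : c * (Fintype.card V : ℝ) ^ (k + 1) ≤ H.card)
    (hn : 2 * (m : ℝ) ^ 2 ≤ c ^ m * Fintype.card V) :
    ∃ A : Fin m → V, Function.Injective A ∧ c ^ (2 * m) * (Fintype.card V : ℝ) ^ k ≤
      ({y : Fin k → V | ∀ a, Fin.cons (A a) y ∈ H} : Finset (Fin k → V)).card := by
  set n := Fintype.card V with hnV
  have hm' : (1 : ℝ) ≤ m := by exact_mod_cast hm
  have hcm : c ^ m ≤ 1 := pow_le_one₀ hc.le (by linarith)
  have hmn' : (m : ℝ) ≤ n := by nlinarith [Nat.cast_nonneg (α := ℝ) n]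
  have hmn : m ≤ n := by exact_mod_cast hmn'
  have hn0 : 0 < n := by omega
  have hn0' : (0 : ℝ) < n := by exact_mod_cast hn0
  let X : (Fin m → V) → Finset (Fin k → V) := fun A ↦ {y | ∀ a, Fin.cons (A a) y ∈ H}
  let D : (Fin k → V) → Finset V := fun y ↦ {v | (Fin.cons v y : Fin (k + 1) → V) ∈ H}
  have hD : H.card = ∑ y, (D y).card := by
    rw [← Finset.card_sigma]
    refine (Finset.card_bij (fun p _ ↦ (Fin.cons p.2 p.1 : Fin (k + 1) → V)) ?_ ?_ ?_).symm
    · rintro ⟨y, v⟩ h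
      simpa [D] using h
    · rintro ⟨y, v⟩ - ⟨y', v'⟩ - h
      obtain ⟨rfl, rfl⟩ := Fin.cons_inj.1 h
      rfl
    · intro x hx
      exact ⟨⟨Fin.tail x, x 0⟩, by simpa [D] using hx, by simp⟩
  have hX : ∑ A, (X A).card = ∑ y, (D y).card ^ m := by
    have : ∀ y, (D y).card ^ m = ∑ A : Fin m → V, if ∀ a, A a ∈ D y then 1 else 0 := by
      intro y
      rw [← Finset.card_filter]
      have : ({A | ∀ a, A a ∈ D y} : Finset (Fin m → V)) = Fintype.piFinset fun _ ↦ D y := by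
        ext; simp
      rw [this, Fintype.card_piFinset]
      simp
    simp_rw [this]
    rw [Finset.sum_comm]
    refine Finset.sum_congr rfl fun A _ ↦ ?_
    rw [← Finset.card_filter]
    simp [X, D]
  obtain ⟨m', rfl⟩ : ∃ m', m = m' + 1 := ⟨m - 1, by omega⟩
  have hjensen : c ^ (m' + 1) * (n : ℝ) ^ (k + (m' + 1)) ≤ ∑ A, ((X A).card : ℝ) := by
    have h1 := pow_sum_div_card_le_sum_pow (s := (Finset.univ : Finset (Fin k → V)))
      (f := fun y ↦ ((D y).card : ℝ)) (fun _ _ ↦ Nat.cast_nonneg _) m'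
    have h2 : ∑ y, ((D y).card : ℝ) = H.card := by exact_mod_cast hD.symm
    have h3 : ∑ y, ((D y).card : ℝ) ^ (m' + 1) = ∑ A, ((X A).card : ℝ) := by exact_mod_cast hX.symm
    rw [h2, h3, Finset.card_univ, Fintype.card_fun, Fintype.card_fin, ← hnV] at h1
    refine le_trans ?_ h1
    rw [le_div_iff₀ (by push_cast; positivity)]
    refine le_trans (le_of_eq ?_) (pow_le_pow_left₀ (by positivity) hH _)
    push_cast
    ring
  by_contra! hcon
  have hc2 : c ^ (2 * (m' + 1)) ≤ c ^ (m' + 1) / 2 := by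
    rw [mul_comm 2, pow_mul, sq, div_eq_mul_one_div]
    gcongr
    exact (pow_le_of_le_one hc.le (by linarith) (by omega)).trans hc1
  have hsplit : ∑ A, ((X A).card : ℝ) < c ^ (m' + 1) * (n : ℝ) ^ (k + (m' + 1)) := by
    rw [← Finset.sum_filter_add_sum_filter_not _ (fun A ↦ Function.Injective A)]
    have h1 : ∑ A with Function.Injective A, ((X A).card : ℝ) <
        ∑ A : Fin (m' + 1) → V with Function.Injective A, c ^ (2 * (m' + 1)) * (n : ℝ) ^ k := by
      refine Finset.sum_lt_sum_of_nonempty ?_ fun A hA ↦ hcon A (Finset.mem_filter.1 hA).2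
      obtain ⟨e⟩ := Function.Embedding.nonempty_of_card_le (α := Fin (m' + 1)) (β := V)
        (by simpa using hmn)
      exact ⟨e, by simpa using e.injective⟩
    have h2 : ∑ A : Fin (m' + 1) → V with Function.Injective A, c ^ (2 * (m' + 1)) * (n : ℝ) ^ k ≤
        (n : ℝ) ^ (m' + 1) * (c ^ (2 * (m' + 1)) * (n : ℝ) ^ k) := by
      rw [Finset.sum_const, nsmul_eq_mul]
      gcongr
      have := Finset.card_filter_le (Finset.univ : Finset (Fin (m' + 1) → V)) Function.Injective
      rw [Finset.card_univ, Fintype.card_fun, Fintype.card_fin] at this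
      exact_mod_cast this
    have h3 : ∑ A with ¬ Function.Injective A, ((X A).card : ℝ) ≤
        (n : ℝ) ^ (m' + 1) * (c ^ (m' + 1) / 2) * (n : ℝ) ^ k := by
      calc ∑ A with ¬ Function.Injective A, ((X A).card : ℝ)
          ≤ ∑ A : Fin (m' + 1) → V with ¬ Function.Injective A, (n : ℝ) ^ k := by
            refine Finset.sum_le_sum fun A _ ↦ ?_
            have := Finset.card_le_univ (X A)
            rw [Fintype.card_fun, Fintype.card_fin] at this
            exact_mod_cast this
        _ ≤ (n : ℝ) ^ (m' + 1) * (((m' + 1 : ℕ) : ℝ) ^ 2 / n) * (n : ℝ) ^ k := by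
            rw [Finset.sum_const, nsmul_eq_mul]
            gcongr
            exact card_not_injective_le _ hn0 hmn
        _ ≤ _ := by
            refine mul_le_mul_of_nonneg_right (mul_le_mul_of_nonneg_left ?_ (by positivity))
              (by positivity)
            rw [div_le_div_iff₀ hn0' two_pos]
            linarith
    have h4 : (n : ℝ) ^ (m' + 1) * (c ^ (2 * (m' + 1)) * (n : ℝ) ^ k) ≤
        (n : ℝ) ^ (m' + 1) * (c ^ (m' + 1) / 2 * (n : ℝ) ^ k) := by gcongr
    calc _ < (n : ℝ) ^ (m' + 1) * (c ^ (m' + 1) / 2 * (n : ℝ) ^ k) +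
          (n : ℝ) ^ (m' + 1) * (c ^ (m' + 1) / 2) * (n : ℝ) ^ k := by linarith
      _ = _ := by ring
  linarith

/-- The theorem of Erdős on complete `(k+1)`-partite `(k+1)`-uniform hypergraphs. -/
theorem exists_box_of_le_card {V : Type*} [Fintype V] {m : ℕ} (hm : 1 ≤ m) (k : ℕ) :
    ∀ {c : ℝ}, 0 < c → c ≤ 1 / 2 → ∀ H : Finset (Fin (k + 1) → V),
      c * (Fintype.card V : ℝ) ^ (k + 1) ≤ H.card →
      2 * (m : ℝ) ^ 2 ≤ c ^ (2 * m) ^ k * Fintype.card V →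
      ∃ A : Fin (k + 1) → Fin m → V, (∀ i, Function.Injective (A i)) ∧
        ∀ g : Fin (k + 1) → Fin m, (fun i ↦ A i (g i)) ∈ H := by
  classical
  have hm' : (1 : ℝ) ≤ m := by exact_mod_cast hm
  induction k with
  | zero =>
    intro c hc hc1 H hH hn
    have h1 : (m : ℝ) ≤ H.card := by
      refine le_trans ?_ hH
      simp only [pow_zero, pow_one, zero_add] at hn ⊢
      nlinarith
    obtain ⟨T, hTH, hT⟩ := Finset.exists_subset_card_eq (by exact_mod_cast h1 : m ≤ H.card)
    let e := T.equivFinOfCardEq hT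
    refine ⟨fun _ a ↦ (e.symm a).1 0, fun i a b hab ↦ ?_, fun g ↦ ?_⟩
    · refine e.symm.injective (Subtype.ext (funext fun j ↦ ?_))
      rw [Subsingleton.elim (α := Fin 1) j 0]; exact hab
    · convert hTH (e.symm (g 0)).2 using 1
      funext i
      rw [Subsingleton.elim (α := Fin 1) i 0]
  | succ k ih =>
    intro c hc hc1 H hH hn
    have h0 : c ^ (2 * m) ^ (k + 1) ≤ c ^ m := by
      refine pow_le_pow_of_le_one hc.le (by linarith) ?_
      calc m ≤ (2 * m) ^ 1 := by rw [pow_one]; omega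
        _ ≤ _ := Nat.pow_le_pow_right (by omega) (by omega)
    obtain ⟨A₀, hA₀, hcard⟩ := exists_injective_le_card_tails hm hc hc1 H hH
      (hn.trans (by gcongr))
    obtain ⟨A, hA, hAH⟩ := ih (c := c ^ (2 * m)) (by positivity)
      ((pow_le_of_le_one hc.le (by linarith) (by omega)).trans hc1) _ hcard
      (by rw [← pow_mul, ← pow_succ']; exact hn)
    refine ⟨Fin.cons A₀ A, fun i ↦ ?_, fun g ↦ ?_⟩
    · refine Fin.cases ?_ (fun i ↦ ?_) i
      · simpa using hA₀
      · simpa using hA i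
    · have := hAH (fun i ↦ g i.succ)
      rw [Finset.mem_filter] at this
      convert this.2 (g 0) using 1
      funext i
      refine Fin.cases ?_ (fun i ↦ ?_) i <;> simp

theorem contains_completeMultipartiteGraph {V : Type} [Fintype V] (G : SimpleGraph V) {r m : ℕ}
    (hm : 1 ≤ m) {c : ℝ} (hc : 0 < c) (hc1 : c ≤ 1 / 2)
    (hG : c * (Fintype.card V : ℝ) ^ (r + 1) ≤
      (cliqueTuples G fun _ : Fin (r + 1) ↦ Finset.univ).card)
    (hn : 2 * (m : ℝ) ^ 2 ≤ c ^ (2 * m) ^ r * Fintype.card V) :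
    Contains (completeMultipartiteGraph fun _ : Fin (r + 1) ↦ Fin m) G := by
  obtain ⟨A, hA, hAG⟩ := exists_box_of_le_card hm r hc hc1 _ hG hn
  have hadj : ∀ i j, i ≠ j → ∀ a b, G.Adj (A i a) (A j b) := by
    intro i j hij a b
    have := (mem_cliqueTuples.1 (hAG (Function.update (fun _ ↦ b) i a))).2 hij
    simpa [Function.update_of_ne hij.symm] using this
  refine ⟨⟨fun v ↦ A v.1 v.2, fun {v w} h ↦ hadj _ _ h _ _⟩, ?_⟩
  rintro ⟨i, a⟩ ⟨j, b⟩ h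
  by_cases hij : i = j
  · subst hij
    rw [hA i (show A i a = A i b from h)]
  · exact absurd h (hadj i j hij a b).ne

theorem unreduced_pairs_subset {V : Type*} [Fintype V] [DecidableEq V] (G : SimpleGraph V)
    [DecidableRel G.Adj] (P : Finpartition (Finset.univ : Finset V)) (ε δ : ℝ) :
    (Finset.univ.filter fun x : V × V ↦ G.Adj x.1 x.2 ∧ ¬ (G.regularityReduced P ε δ).Adj x.1 x.2) ⊆
      (P.nonUniforms G ε).biUnion (fun UV ↦ UV.1 ×ˢ UV.2) ∪ P.parts.biUnion Finset.offDiag ∪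
        (P.sparsePairs G δ).biUnion fun UV ↦ G.interedges UV.1 UV.2 := by
  rintro ⟨x, y⟩ h
  have hadj : G.Adj x y := (Finset.mem_filter.1 h).2.1
  have h' := (Finset.mem_filter.1 h).2.2
  clear h
  obtain ⟨U, hU, hx⟩ := P.exists_mem (Finset.mem_univ x)
  obtain ⟨W, hW, hy⟩ := P.exists_mem (Finset.mem_univ y)
  simp only [Finset.mem_union, Finset.mem_biUnion, Finset.mem_offDiag, Finset.mem_product,
    Prod.exists, P.mk_mem_nonUniforms, Finpartition.mk_mem_sparsePairs, mem_interedges_iff,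
    regularityReduced_adj, not_and, not_exists, not_le] at *
  by_cases hUW : U = W
  · subst hUW
    exact Or.inl (Or.inr ⟨U, hU, hx, hy, hadj.ne⟩)
  by_cases hu : G.IsUniform ε U W
  · exact Or.inr ⟨U, W, ⟨hU, hW, hUW, h' hadj _ hU _ hW hx hy hUW hu⟩, hx, hy, hadj⟩
  · exact Or.inl (Or.inl ⟨U, W, ⟨hU, hW, hUW, hu⟩, hx, hy⟩)

theorem card_unreduced_pairs_le {V : Type*} [Fintype V] [Nonempty V] [DecidableEq V]
    (G : SimpleGraph V) [DecidableRel G.Adj] (P : Finpartition (Finset.univ : Finset V))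
    (hP : P.IsEquipartition) {ε δ γ : ℝ} (hε : 0 < ε) (hδ : 0 < δ) (hγ : 0 < γ)
    (hεγ : 16 * ε ≤ γ) (hδγ : 16 * δ ≤ γ) (hu : P.IsUniform G ε) (hl : 4 / γ ≤ P.parts.card) :
    ((Finset.univ.filter fun x : V × V ↦
      G.Adj x.1 x.2 ∧ ¬ (G.regularityReduced P ε δ).Adj x.1 x.2).card : ℝ) ≤
      γ * (Fintype.card V : ℝ) ^ 2 := by
  have h1 := hP.sum_nonUniforms_lt (G := G) Finset.univ_nonempty hε hu
  have h2 := hP.card_biUnion_offDiag_le hγ hl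
  have h3 := hP.card_interedges_sparsePairs_le (G := G) (ε := δ) hδ.le
  rw [Finset.card_univ] at h1 h2 h3
  have h4 := Finset.card_le_card (unreduced_pairs_subset G P ε δ)
  have h5 := h4.trans ((Finset.card_union_le _ _).trans
    (Nat.add_le_add_right (Finset.card_union_le _ _) _))
  have h6 : ((Finset.univ.filter fun x : V × V ↦
      G.Adj x.1 x.2 ∧ ¬ (G.regularityReduced P ε δ).Adj x.1 x.2).card : ℝ) ≤ _ :=
    Nat.cast_le.2 h5
  push_cast at h6
  have hn : (0 : ℝ) ≤ (Fintype.card V : ℝ) ^ 2 := by positivity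
  nlinarith

theorem IsUniform.mul_le_card_interedges {V : Type*} [DecidableEq V] {G : SimpleGraph V}
    [DecidableRel G.Adj] {ε d : ℝ} {U W s t : Finset V} (hu : G.IsUniform ε U W)
    (hd : d + ε ≤ G.edgeDensity U W) (hs : s ⊆ U) (ht : t ⊆ W) (hsU : (U.card : ℝ) * ε ≤ s.card)
    (htW : (W.card : ℝ) * ε ≤ t.card) : d * s.card * t.card ≤ (G.interedges s t).card := by
  have h1 := abs_lt.1 (hu hs ht hsU htW)
  have h2 : d ≤ (G.edgeDensity s t : ℝ) := by linarith
  have h3 : (G.edgeDensity s t : ℝ) * (s.card * t.card) = (G.interedges s t).card := by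
    rw [SimpleGraph.edgeDensity_def]
    push_cast
    refine div_mul_cancel_of_imp fun h0 ↦ ?_
    have := G.card_interedges_le_mul s t
    rw [← Nat.cast_mul, Nat.cast_eq_zero] at h0
    rw [h0] at this
    exact_mod_cast Nat.le_zero.1 this
  rw [← h3, mul_assoc]
  gcongr

open scoped Classical in
/-- If `G` has few `(r+1)`-cliques, then up to few edges it is contained in a blow-up of a
`K_{r+1}`-free graph of bounded order. -/
theorem exists_comap_cliqueFree {r : ℕ} {γ : ℝ} (hγ : 0 < γ) :
    ∃ K : ℕ, ∃ c > 0, ∃ N : ℕ, ∀ n ≥ N, ∀ G : SimpleGraph (Fin n),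
      ((cliqueTuples G fun _ : Fin (r + 1) ↦ Finset.univ).card : ℝ) < c * (n : ℝ) ^ (r + 1) →
      ∃ p : Fin n → Fin K, ∃ S : SimpleGraph (Fin K), (S.comap p).CliqueFree (r + 1) ∧
        ((G.edgeFinset \ (S.comap p).edgeFinset).card : ℝ) ≤ γ * (n : ℝ) ^ 2 := by
  set d := min (γ / 32) 1 with hd
  have hd0 : 0 < d := by positivity
  have hd1 : d ≤ 1 := min_le_right _ _
  have hdγ : d ≤ γ / 32 := min_le_left _ _
  obtain ⟨η, hη, c, hc, hcount⟩ := exists_le_card_cliqueTuples (r + 1) d hd0 hd1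
  set ε := min (η / 2) d with hε
  have hε0 : 0 < ε := by positivity
  have hεη : ε ≤ η / 2 := min_le_left _ _
  have hεd : ε ≤ d := min_le_right _ _
  let l := ⌈4 / γ⌉₊ + 1
  let K := SzemerediRegularity.bound ε l
  have hK : 0 < K := SzemerediRegularity.bound_pos _ _
  refine ⟨K, c / (2 * K) ^ (r + 1), by positivity, max l K, fun n hn G hG ↦ ?_⟩
  have hln : l ≤ n := (le_max_left _ _).trans hn
  have hKn : K ≤ n := (le_max_right _ _).trans hn
  have : Nonempty (Fin n) := ⟨⟨0, by omega⟩⟩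
  obtain ⟨P, hPe, hPl, hPK, hPu⟩ := szemeredi_regularity G (l := l) hε0 (by simpa using hln)
  obtain ⟨φ⟩ := Function.Embedding.nonempty_of_card_le (α := P.parts) (β := Fin K)
    (by simpa using hPK)
  let W : Fin K → Finset (Fin n) := Function.extend φ (fun U ↦ U.1) fun _ ↦ ∅
  have hW : ∀ U, W (φ U) = U.1 := fun U ↦ φ.injective.extend_apply _ _ _
  let R : Fin K → Fin K → Prop := fun u v ↦ W u ∈ P.parts ∧ W v ∈ P.parts ∧ W u ≠ W v ∧
    G.IsUniform ε (W u) (W v) ∧ 2 * d ≤ G.edgeDensity (W u) (W v)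
  let S : SimpleGraph (Fin K) :=
    { Adj := R
      symm := ⟨fun u v ⟨h1, h2, h3, h4, h5⟩ ↦
        ⟨h2, h1, h3.symm, h4.symm, by rwa [edgeDensity_comm]⟩⟩
      loopless := ⟨fun u h ↦ h.2.2.1 rfl⟩ }
  let p : Fin n → Fin K := fun v ↦ φ ⟨P.part v, P.part_mem.2 (Finset.mem_univ v)⟩
  have hred : G.regularityReduced P ε (2 * d) ≤ S.comap p := by
    rintro a b ⟨-, U, hU, U', hU', ha, hb, hne, hu, hdens⟩
    have e1 : W (p a) = U := by rw [hW]; exact P.part_eq_of_mem hU ha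
    have e2 : W (p b) = U' := by rw [hW]; exact P.part_eq_of_mem hU' hb
    change R (p a) (p b)
    simp only [R, e1, e2]
    exact ⟨hU, hU', hne, hu, hdens⟩
  refine ⟨p, S, ?_, ?_⟩
  · by_contra hcl
    rw [not_cliqueFree_iff_top_isContained] at hcl
    obtain ⟨f⟩ := hcl
    have hR : ∀ i j, i ≠ j → R (p (f i)) (p (f j)) := fun i j hij ↦
      f.toHom.map_adj hij
    let a := n / P.parts.card
    have hP0 : 0 < P.parts.card := by omega
    have hPn : P.parts.card ≤ n := hPK.trans hKn
    have ha : 1 ≤ a := (Nat.one_le_div_iff hP0).2 hPn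
    have ha' : (1 : ℝ) ≤ a := by exact_mod_cast ha
    have hpart : ∀ v, W (p v) ∈ P.parts := fun v ↦ by
      rw [hW]; exact P.part_mem.2 (Finset.mem_univ v)
    have hWa : ∀ v, a ≤ (W (p v)).card := fun v ↦ by
      simpa using hPe.average_le_card_part (hpart v)
    have hWa' : ∀ v, (W (p v)).card ≤ a + 1 := fun v ↦ by
      simpa using hPe.card_part_le_average_add_one (hpart v)
    have hlarge : ∀ v, ∀ s : Finset (Fin n), η * a ≤ s.card → ((W (p v)).card : ℝ) * ε ≤ s.card := by
      intro v s hs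
      have : ((W (p v)).card : ℝ) ≤ a + 1 := by exact_mod_cast hWa' v
      refine le_trans ?_ hs
      nlinarith
    have h1 := hcount G a (by linarith) (fun i ↦ W (p (f i)))
      (fun i ↦ by exact_mod_cast hWa (f i)) (fun i j hij s hs t ht hsa hta ↦ by
        obtain ⟨-, -, -, hu, hdens⟩ := hR i j hij
        exact IsUniform.mul_le_card_interedges hu (by linarith) hs ht (hlarge _ _ hsa)
          (hlarge _ _ hta))
    have h2 : (cliqueTuples G fun i ↦ W (p (f i))).card ≤
        (cliqueTuples G fun _ : Fin (r + 1) ↦ Finset.univ).card :=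
      Finset.card_le_card fun x hx ↦
        mem_cliqueTuples.2 ⟨fun _ ↦ Finset.mem_univ _, (mem_cliqueTuples.1 hx).2⟩
    have h3 : (n : ℝ) ≤ 2 * K * a := by
      have h4 : n < (a + 1) * P.parts.card := by
        rw [mul_comm]; exact Nat.lt_mul_div_succ n hP0
      have h5 : (a + 1) * P.parts.card ≤ (2 * a) * K := Nat.mul_le_mul (by omega) hPK
      have h6 : (n : ℝ) ≤ ((2 * a * K : ℕ) : ℝ) := by exact_mod_cast (h4.trans_le h5).le
      push_cast at h6
      linarith
    have h4 : c / (2 * K) ^ (r + 1) * (n : ℝ) ^ (r + 1) ≤ c * (a : ℝ) ^ (r + 1) := by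
      calc c / (2 * K) ^ (r + 1) * (n : ℝ) ^ (r + 1)
          ≤ c / (2 * K) ^ (r + 1) * (2 * K * a) ^ (r + 1) := by gcongr
        _ = _ := by rw [mul_pow (2 * (K : ℝ))]; field_simp
    have h5 : ((cliqueTuples G fun i ↦ W (p (f i))).card : ℝ) ≤
        (cliqueTuples G fun _ : Fin (r + 1) ↦ Finset.univ).card := by exact_mod_cast h2
    linarith
  · have h1 := card_unreduced_pairs_le G P hPe hε0 (δ := 2 * d) (by positivity) hγ (by linarith)
      (by linarith) hPu ((Nat.le_ceil _).trans (by exact_mod_cast (by omega : ⌈4 / γ⌉₊ ≤ _)))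
    rw [Fintype.card_fin] at h1
    refine le_trans ?_ h1
    refine Nat.cast_le.2 ((Finset.card_le_card ?_).trans
      (Finset.card_image_le (f := fun x : Fin n × Fin n ↦ s(x.1, x.2))))
    intro e he
    induction e using Sym2.ind with
    | _ x y =>
      simp only [Finset.mem_sdiff, mem_edgeFinset, mem_edgeSet] at he
      exact Finset.mem_image.2 ⟨(x, y), Finset.mem_filter.2 ⟨Finset.mem_univ _, he.1,
        fun h ↦ he.2 (hred h)⟩, rfl⟩

open scoped Classical in
theorem card_edgeFinset_le_of_cliqueFree {n r : ℕ} (hr : 0 < r) {B : SimpleGraph (Fin n)}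
    [DecidableRel B.Adj] (hB : B.CliqueFree (r + 1)) :
    (B.edgeFinset.card : ℝ) ≤ (1 - 1 / (r : ℝ)) * (n : ℝ) ^ 2 / 2 := by
  have h1 : B.edgeFinset.card ≤ (turanGraph n r).edgeFinset.card := by
    convert (isTuranMaximal_turanGraph (n := n) hr).2 hB
  have h2 : 2 * r * (turanGraph n r).edgeFinset.card ≤ (r - 1) * n ^ 2 := by
    convert mul_card_edgeFinset_turanGraph_le (n := n) (r := r)
  have h3 : 2 * r * B.edgeFinset.card ≤ (r - 1) * n ^ 2 := le_trans (by gcongr) h2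
  have h4 : 2 * (r : ℝ) * B.edgeFinset.card ≤ (r - 1) * (n : ℝ) ^ 2 := by
    have : ((2 * r * B.edgeFinset.card : ℕ) : ℝ) ≤ (((r - 1) * n ^ 2 : ℕ) : ℝ) := by exact_mod_cast h3
    rw [Nat.cast_mul (r - 1), Nat.cast_sub (by omega)] at this
    push_cast at this
    exact this
  have hr' : (0 : ℝ) < r := by exact_mod_cast hr
  rw [le_div_iff₀ two_pos, one_sub_div hr'.ne', div_mul_eq_mul_div, le_div_iff₀ hr']
  linarith

/-- A set has few subsets whose size is a small fraction of `T`. -/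
theorem exists_card_small_subsets_le {γ : ℝ} (hγ : 0 < γ) :
    ∃ η > 0, ∀ {α : Type} (E : Finset α) (T : ℝ), (E.card : ℝ) ≤ T →
      ((E.powerset.filter fun s ↦ (s.card : ℝ) ≤ η * T).card : ℝ) ≤ (2 : ℝ) ^ (γ * T) := by
  have hlog : 0 < Real.log 2 := Real.log_pos one_lt_two
  set g := γ * Real.log 2 / 2 with hg
  have hg0 : 0 < g := by positivity
  set x := min g 1 with hx
  have hx0 : 0 < x := by positivity
  have hx1 : x ≤ 1 := min_le_right _ _
  have hlx : Real.log x ≤ 0 := Real.log_nonpos hx0.le hx1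
  refine ⟨g / (1 - Real.log x), div_pos hg0 (by linarith), fun {α} E T hT ↦ ?_⟩
  set η := g / (1 - Real.log x) with hη
  have hT0 : 0 ≤ T := (Nat.cast_nonneg _).trans hT
  have hηg : -Real.log x * η ≤ g := by
    rw [hη, ← mul_div_assoc, div_le_iff₀ (by linarith)]
    nlinarith
  calc ((E.powerset.filter fun s ↦ (s.card : ℝ) ≤ η * T).card : ℝ)
      = ∑ s ∈ E.powerset.filter fun s ↦ (s.card : ℝ) ≤ η * T, (1 : ℝ) := by simp
    _ ≤ ∑ s ∈ E.powerset.filter fun s ↦ (s.card : ℝ) ≤ η * T, x ^ s.card * x ^ (-(η * T)) := by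
        refine Finset.sum_le_sum fun s hs ↦ ?_
        rw [← Real.rpow_natCast, ← Real.rpow_add hx0]
        refine Real.one_le_rpow_of_pos_of_le_one_of_nonpos hx0 hx1 ?_
        linarith [(Finset.mem_filter.1 hs).2]
    _ ≤ ∑ s ∈ E.powerset, x ^ s.card * x ^ (-(η * T)) :=
        Finset.sum_le_sum_of_subset_of_nonneg (Finset.filter_subset _ _)
          fun _ _ _ ↦ by positivity
    _ = (x + 1) ^ E.card * x ^ (-(η * T)) := by
        rw [← Finset.sum_mul, ← Finset.sum_pow_mul_eq_add_pow]
        simp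
    _ ≤ Real.exp (g * T) * Real.exp (g * T) := by
        gcongr
        · calc (x + 1) ^ E.card ≤ Real.exp x ^ E.card := by
                gcongr
                exact Real.add_one_le_exp x
            _ = Real.exp (E.card * x) := (Real.exp_nat_mul _ _).symm
            _ ≤ _ := by
                rw [Real.exp_le_exp, mul_comm]
                exact mul_le_mul (min_le_left _ _) hT (Nat.cast_nonneg _) hg0.le
        · rw [Real.rpow_def_of_pos hx0]
          rw [Real.exp_le_exp]
          nlinarith
    _ = _ := by
        rw [← Real.exp_add, Real.rpow_def_of_pos two_pos]
        congr 1
        rw [hg]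
        ring

open scoped Classical in
theorem card_filter_sdiff_edgeFinset_le {V : Type*} [Fintype V] (B : SimpleGraph V)
    [DecidableRel B.Adj] (t : ℝ) :
    (({G : SimpleGraph V | ((G.edgeFinset \ B.edgeFinset).card : ℝ) ≤ t} :
      Finset (SimpleGraph V)).card) ≤ 2 ^ B.edgeFinset.card *
      ((⊤ : SimpleGraph V).edgeFinset.powerset.filter fun s ↦ (s.card : ℝ) ≤ t).card := by
  rw [← Finset.card_powerset, ← Finset.card_product]
  refine Finset.card_le_card_of_injOn
    (fun G ↦ (G.edgeFinset ∩ B.edgeFinset, G.edgeFinset \ B.edgeFinset)) ?_ ?_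
  · intro G hG
    rw [Finset.mem_coe, Finset.mem_filter] at hG
    simp only [Finset.mem_coe, Finset.mem_product, Finset.mem_powerset, Finset.mem_filter]
    exact ⟨Finset.inter_subset_right, Finset.sdiff_subset.trans (edgeFinset_mono le_top), hG.2⟩
  · intro G _ G' _ h
    obtain ⟨h1, h2⟩ := Prod.mk.inj h
    rw [← edgeFinset_inj, ← Finset.sdiff_union_inter G.edgeFinset B.edgeFinset, h1, h2,
      Finset.sdiff_union_inter]

open scoped Classical in
/-- Counting graphs that are nearly contained in a blow-up of a `K_{r+1}`-free graph. -/
theorem card_le_of_exists_comap_cliqueFree {n K r : ℕ} (hr : 0 < r) {γ η : ℝ}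
    (hη : ∀ {α : Type} (E : Finset α) (T : ℝ), (E.card : ℝ) ≤ T →
      ((E.powerset.filter fun s ↦ (s.card : ℝ) ≤ η * T).card : ℝ) ≤ (2 : ℝ) ^ (γ * T))
    (F : Finset (SimpleGraph (Fin n)))
    (hF : ∀ G ∈ F, ∃ p : Fin n → Fin K, ∃ S : SimpleGraph (Fin K),
      (S.comap p).CliqueFree (r + 1) ∧
        ((G.edgeFinset \ (S.comap p).edgeFinset).card : ℝ) ≤ η * (n : ℝ) ^ 2) :
    (F.card : ℝ) ≤ (K : ℝ) ^ n * Fintype.card (SimpleGraph (Fin K)) *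
      ((2 : ℝ) ^ ((1 - 1 / (r : ℝ)) * (n : ℝ) ^ 2 / 2) * (2 : ℝ) ^ (γ * (n : ℝ) ^ 2)) := by
  let I : Finset ((Fin n → Fin K) × SimpleGraph (Fin K)) :=
    {q | (q.2.comap q.1).CliqueFree (r + 1)}
  let C : ((Fin n → Fin K) × SimpleGraph (Fin K)) → Finset (SimpleGraph (Fin n)) := fun q ↦
    {G | ((G.edgeFinset \ (q.2.comap q.1).edgeFinset).card : ℝ) ≤ η * (n : ℝ) ^ 2}
  have hsub : F ⊆ I.biUnion C := by
    intro G hG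
    obtain ⟨p, S, h1, h2⟩ := hF G hG
    exact Finset.mem_biUnion.2 ⟨(p, S), Finset.mem_filter.2 ⟨Finset.mem_univ _, h1⟩,
      Finset.mem_filter.2 ⟨Finset.mem_univ _, h2⟩⟩
  have hE : ((⊤ : SimpleGraph (Fin n)).edgeFinset.card : ℝ) ≤ (n : ℝ) ^ 2 := by
    have h1 := (⊤ : SimpleGraph (Fin n)).card_edgeFinset_le_card_choose_two
    rw [Fintype.card_fin] at h1
    have h2 : (⊤ : SimpleGraph (Fin n)).edgeFinset.card ≤ n ^ 2 := h1.trans (Nat.choose_le_pow n 2)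
    exact_mod_cast h2
  have hC : ∀ q ∈ I, ((C q).card : ℝ) ≤
      (2 : ℝ) ^ ((1 - 1 / (r : ℝ)) * (n : ℝ) ^ 2 / 2) * (2 : ℝ) ^ (γ * (n : ℝ) ^ 2) := by
    intro q hq
    have h1 : (C q).card ≤ 2 ^ (q.2.comap q.1).edgeFinset.card *
        ((⊤ : SimpleGraph (Fin n)).edgeFinset.powerset.filter fun s ↦
          (s.card : ℝ) ≤ η * (n : ℝ) ^ 2).card := by
      convert card_filter_sdiff_edgeFinset_le (q.2.comap q.1) (η * (n : ℝ) ^ 2)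
    refine (Nat.cast_le (α := ℝ).2 h1).trans ?_
    push_cast
    gcongr
    · rw [← Real.rpow_natCast]
      gcongr
      · norm_num
      · exact card_edgeFinset_le_of_cliqueFree hr (Finset.mem_filter.1 hq).2
    · exact hη _ _ hE
  calc (F.card : ℝ) ≤ ((I.biUnion C).card : ℝ) := by exact_mod_cast Finset.card_le_card hsub
    _ ≤ ∑ q ∈ I, ((C q).card : ℝ) := by exact_mod_cast Finset.card_biUnion_le
    _ ≤ I.card * _ := by
        rw [← nsmul_eq_mul, ← Finset.sum_const]
        exact Finset.sum_le_sum hC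
    _ ≤ _ := by
        gcongr
        have := Finset.card_le_univ I
        rw [Fintype.card_prod, Fintype.card_fun, Fintype.card_fin, Fintype.card_fin] at this
        exact_mod_cast this

theorem eventually_two_mul_log_sq_le :
    ∀ᶠ n : ℕ in Filter.atTop, 2 * Real.log n ^ 2 ≤ (n : ℝ) ^ (1 / 2 : ℝ) := by
  have h1 : (fun x : ℝ ↦ Real.log x ^ (2 : ℝ)) =o[Filter.atTop] fun x ↦ x ^ (1 / 2 : ℝ) :=
    isLittleO_log_rpow_rpow_atTop 2 (by norm_num)
  have h2 := tendsto_natCast_atTop_atTop.eventually (h1.bound (c := 1 / 2) (by norm_num))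
  filter_upwards [h2] with n hn
  rw [Real.norm_of_nonneg (by positivity : (0 : ℝ) ≤ (n : ℝ) ^ (1 / 2 : ℝ)), Real.rpow_two,
    Real.norm_of_nonneg (by positivity)] at hn
  linarith

theorem two_mul_sq_floor_le {r n : ℕ} (hr : 1 ≤ r) {c δ : ℝ} (hc : 0 < c) (hδ : 0 < δ)
    (hδ1 : 2 * δ ≤ 1) (hδc : 2 * δ * -Real.log c ≤ 1 / 2) (hn : 0 < n) (hlog : 1 ≤ Real.log n)
    (hlog2 : 2 * Real.log n ^ 2 ≤ (n : ℝ) ^ (1 / 2 : ℝ)) (hc1 : c ≤ 1) :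
    2 * (⌊δ * Real.log n ^ (1 / (r : ℝ))⌋₊ : ℝ) ^ 2 ≤
      c ^ (2 * ⌊δ * Real.log n ^ (1 / (r : ℝ))⌋₊) ^ r * n := by
  set m := ⌊δ * Real.log n ^ (1 / (r : ℝ))⌋₊ with hm
  have hn' : (0 : ℝ) < n := by exact_mod_cast hn
  have hr' : (1 : ℝ) ≤ r := by exact_mod_cast hr
  have hlog0 : 0 ≤ Real.log n := by linarith
  have hm1 : (m : ℝ) ≤ δ * Real.log n ^ (1 / (r : ℝ)) := Nat.floor_le (by positivity)
  have hmlog : (m : ℝ) ≤ Real.log n := by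
    have h1 : Real.log n ^ (1 / (r : ℝ)) ≤ Real.log n ^ (1 : ℝ) :=
      Real.rpow_le_rpow_of_exponent_le hlog (by rw [div_le_one (by linarith)]; exact hr')
    rw [Real.rpow_one] at h1
    nlinarith
  have hpow : (2 * (m : ℝ)) ^ r ≤ 2 * δ * Real.log n := by
    calc (2 * (m : ℝ)) ^ r ≤ (2 * δ * Real.log n ^ (1 / (r : ℝ))) ^ r := by
          gcongr ?_ ^ r
          linarith
      _ = (2 * δ) ^ r * Real.log n := by
          rw [mul_pow, one_div, Real.rpow_inv_natCast_pow hlog0 (by omega)]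
      _ ≤ _ := by
          gcongr
          exact pow_le_of_le_one (by positivity) hδ1 (by omega)
  have hlc : 0 ≤ -Real.log c := by linarith [Real.log_nonpos hc.le hc1]
  calc 2 * (m : ℝ) ^ 2 ≤ 2 * Real.log n ^ 2 := by gcongr
    _ ≤ (n : ℝ) ^ (1 / 2 : ℝ) := hlog2
    _ = Real.exp (-(1 / 2 * Real.log n)) * n := by
        nth_rw 3 [← Real.exp_log hn']
        rw [← Real.exp_add, Real.rpow_def_of_pos hn']
        congr 1
        ring
    _ ≤ c ^ (2 * m) ^ r * n := by
        gcongr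
        rw [← Real.rpow_natCast, Real.rpow_def_of_pos hc, Real.exp_le_exp]
        push_cast
        have h1 := mul_le_mul_of_nonneg_left hpow hlc
        nlinarith

theorem contains_of_isEmpty {α β : Type*} [IsEmpty α] (H : SimpleGraph α) (G : SimpleGraph β) :
    Contains H G :=
  ⟨⟨isEmptyElim, fun {a} ↦ isEmptyElim a⟩, fun a ↦ isEmptyElim a⟩

/-- The numerical estimate turning a bound on a cardinality into one on its logarithm. -/
theorem logb_le_of_le_mul_rpow {N K C n : ℕ} {β ε : ℝ} (hβ : β ≤ 1) (hε : 0 < ε)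
    (hN : (N : ℝ) ≤ (K : ℝ) ^ n * C *
      ((2 : ℝ) ^ (β * (n : ℝ) ^ 2 / 2) * (2 : ℝ) ^ (ε / 8 * (n : ℝ) ^ 2)))
    (hβ0 : 0 ≤ β) (hn : 1 ≤ n)
    (hlarge : 8 * (|Real.logb 2 K| + |Real.logb 2 C| + 1 + ε) ≤ ε * n) :
    Real.logb 2 N ≤ (β + ε) * (n.choose 2 : ℝ) := by
  have hn' : (1 : ℝ) ≤ n := by exact_mod_cast hn
  rcases Nat.eq_zero_or_pos N with rfl | hN0
  · simp only [Nat.cast_zero, Real.logb_zero]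
    positivity
  have hN0' : (0 : ℝ) < N := by exact_mod_cast hN0
  have hKC : (K : ℝ) ^ n * C ≠ 0 := left_ne_zero_of_mul (hN0'.trans_le hN).ne'
  have h1 := Real.logb_le_logb_of_le one_lt_two hN0' hN
  rw [Real.logb_mul hKC (by positivity), Real.logb_mul (left_ne_zero_of_mul hKC)
    (right_ne_zero_of_mul hKC), Real.logb_mul (by positivity) (by positivity), Real.logb_pow,
    Real.logb_rpow two_pos (by norm_num), Real.logb_rpow two_pos (by norm_num)] at h1
  refine h1.trans ?_
  rw [Nat.cast_choose_two]
  have h2 := le_abs_self (Real.logb 2 K)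
  have h3 := le_abs_self (Real.logb 2 C)
  have h4 := abs_nonneg (Real.logb 2 C)
  have h5 : (n : ℝ) * Real.logb 2 K ≤ n * |Real.logb 2 K| := by gcongr
  have h6 : |Real.logb 2 C| ≤ n * |Real.logb 2 C| := le_mul_of_one_le_left h4 hn'
  have h7 := mul_le_mul_of_nonneg_left hlarge (by linarith : (0 : ℝ) ≤ n)
  have h8 : β * n ≤ n := mul_le_of_le_one_left (by linarith) hβ
  nlinarith

theorem stmt12 (r : ℕ) (hr : 2 ≤ r) (ε : ℝ) (hε : 0 < ε) :
    ∃ δ : ℝ, 0 < δ ∧ ∃ N : ℕ, ∀ n ≥ N,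
      Real.logb 2 (Nat.card {G : SimpleGraph (Fin n) //
        ¬ Contains (SimpleGraph.completeMultipartiteGraph
            fun _ : Fin (r+1) => Fin ⌊δ * (Real.log n)^(1/(r:ℝ))⌋₊) G}) ≤
        (1 - 1/(r:ℝ) + ε) * (n.choose 2 : ℝ) := by
  classical
  obtain ⟨η, hη, hsmall⟩ := exists_card_small_subsets_le (γ := ε / 8) (by positivity)
  obtain ⟨K, c', hc', N, hcont⟩ := exists_comap_cliqueFree (r := r) hη
  set c := min c' (1 / 2) with hc
  have hc0 : 0 < c := by positivity
  have hc2 : c ≤ 1 / 2 := min_le_right _ _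
  have hlogc : 0 < -Real.log c := by linarith [Real.log_neg hc0 (by linarith)]
  set δ := min (1 / 2) (1 / (4 * -Real.log c)) with hδ
  have hδ0 : 0 < δ := by positivity
  have hδ1 : 2 * δ ≤ 1 := by linarith [min_le_left (1 / 2) (1 / (4 * -Real.log c))]
  have hδc : 2 * δ * -Real.log c ≤ 1 / 2 := by
    have h1 : δ ≤ 1 / (4 * -Real.log c) := min_le_right _ _
    rw [le_div_iff₀ (by positivity)] at h1
    linarith
  refine ⟨δ, hδ0, ?_⟩
  rw [← Filter.eventually_atTop]
  filter_upwards [Filter.eventually_ge_atTop N, Filter.eventually_ge_atTop 1,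
    eventually_two_mul_log_sq_le,
    (Real.tendsto_log_atTop.comp tendsto_natCast_atTop_atTop).eventually_ge_atTop 1,
    (tendsto_natCast_atTop_atTop.const_mul_atTop hε).eventually_ge_atTop
      (8 * (|Real.logb 2 K| + |Real.logb 2 (Fintype.card (SimpleGraph (Fin K)))| + 1 + ε))]
    with n hnN hn1 hlog2 hlog hlarge
  have hr' : (1 : ℝ) ≤ r := by exact_mod_cast (by omega : 1 ≤ r)
  have hr1 : 1 / (r : ℝ) ≤ 1 := (div_le_one (by linarith)).2 hr'
  have hr0 : 0 ≤ 1 / (r : ℝ) := by positivity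
  rw [Nat.card_eq_fintype_card, Fintype.card_subtype]
  refine logb_le_of_le_mul_rpow (by linarith) hε
    (card_le_of_exists_comap_cliqueFree (by omega) hsmall _ fun G hG ↦ ?_) (by linarith) hn1 hlarge
  refine hcont n hnN G ?_
  by_contra! hmany
  refine (Finset.mem_filter.1 hG).2 ?_
  rcases Nat.eq_zero_or_pos ⌊δ * Real.log n ^ (1 / (r : ℝ))⌋₊ with hm | hm
  · have : IsEmpty ((_ : Fin (r + 1)) × Fin ⌊δ * Real.log n ^ (1 / (r : ℝ))⌋₊) := by
      rw [hm]; exact ⟨fun v ↦ v.2.elim0⟩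
    exact contains_of_isEmpty _ _
  · refine contains_completeMultipartiteGraph G hm hc0 hc2 ?_ ?_
    · rw [Fintype.card_fin]
      refine le_trans ?_ hmany
      gcongr
      exact min_le_left _ _
    · rw [Fintype.card_fin]
      exact two_mul_sq_floor_le (by omega) hc0 hδ0 hδ1 hδc hn1 hlog hlog2 (by linarith)
end
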